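/- arXiv:1804.07267 — 5 statements merged into one kernel-verified Lean document; each statement's English description precedes it below -/
import Mathlib

section
/- For every n ≥ 1, the number of quasi-Stirling permutations of the multiset [n,n] equals n! · C_n, where C_n is the n-th Catalan number. -/
/-- `π : Fin (2*n) → Fin n` encodes a permutation of the multiset
`{1,1,2,2,…,n,n}`: every value appears exactly twice. -/
def IsMultisetPerm (n : ℕ) (π : Fin (2 * n) → Fin n) : Prop :=
  ∀ v : Fin n, Nat.card {i : Fin (2 * n) // π i = v} = 2

/-- `π` avoids the pattern 1212. -/
def Avoids1212 (n : ℕ) (π : Fin (2 * n) → Fin n) : Prop :=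
  ¬ ∃ i j k l : Fin (2 * n), i < j ∧ j < k ∧ k < l ∧
      π i = π k ∧ π j = π l ∧ π i < π j

/-- `π` avoids the pattern 2121. -/
def Avoids2121 (n : ℕ) (π : Fin (2 * n) → Fin n) : Prop :=
  ¬ ∃ i j k l : Fin (2 * n), i < j ∧ j < k ∧ k < l ∧
      π i = π k ∧ π j = π l ∧ π j < π i

/-- A quasi-Stirling permutation: a permutation of the multiset `[n,n]`
avoiding both 1212 and 2121. -/
def IsQuasiStirling (n : ℕ) (π : Fin (2 * n) → Fin n) : Prop :=
  IsMultisetPerm n π ∧ Avoids1212 n π ∧ Avoids2121 n π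

/-- `π` contains the length-3 pattern `σ` (with distinct entries):
there are positions `i₁ < i₂ < i₃` whose values are in the same relative
order as `σ`. -/
def Contains3 (n : ℕ) (σ : Fin 3 → ℕ) (π : Fin (2 * n) → Fin n) : Prop :=
  ∃ f : Fin 3 → Fin (2 * n), StrictMono f ∧
    ∀ a b : Fin 3, π (f a) < π (f b) ↔ σ a < σ b

/-- `π` avoids the length-3 pattern `σ`. -/
def Avoids3 (n : ℕ) (σ : Fin 3 → ℕ) (π : Fin (2 * n) → Fin n) : Prop :=
  ¬ Contains3 n σ π

namespace QuasiStirling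

open List

variable {α : Type*}

/-- A word is noncrossing if no two distinct letters alternate as `a b a b`. -/
def Noncrossing (l : List α) : Prop :=
  ∀ a b, a ≠ b → ¬ [a, b, a, b] <+ l

/-- The preorder listing of the labels of a binary tree. -/
def labels : BinaryTree α → List α
  | .nil => []
  | .node a l r => a :: (labels l ++ labels r)

/-- The word obtained from a labelled binary tree by writing each label before and after the
word of its left subtree. -/
def word : BinaryTree α → List α
  | .nil => []
  | .node a l r => a :: (word l ++ a :: word r)

theorem Noncrossing.of_sublist {l l' : List α} (h : Noncrossing l') (hl : l <+ l') :
    Noncrossing l := fun a b hab hs => h a b hab (hs.trans hl)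

theorem mem_word {t : BinaryTree α} {a : α} : a ∈ word t ↔ a ∈ labels t := by
  induction t with
  | nil => simp [word, labels]
  | node b l r hl hr => simp [word, labels, hl, hr]; tauto

theorem count_word [DecidableEq α] (t : BinaryTree α) (a : α) :
    (word t).count a = 2 * (labels t).count a := by
  induction t with
  | nil => simp [word, labels]
  | node b l r hl hr => simp [word, labels, count_cons, hl, hr]; ring

theorem length_word (t : BinaryTree α) : (word t).length = 2 * (labels t).length := by
  induction t with
  | nil => simp [word, labels]
  | node b l r hl hr => simp [word, labels, hl, hr]; ring

theorem eq_of_word_eq {t t' : BinaryTree α} (ht : (labels t).Nodup) (ht' : (labels t').Nodup)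
    (h : word t = word t') : t = t' := by
  induction t generalizing t' with
  | nil => cases t' <;> simp_all [word]
  | node a l r hl hr =>
    cases t' with
    | nil => simp [word] at h
    | node a' l' r' =>
      simp only [labels, nodup_cons, mem_append, not_or, nodup_append] at ht ht'
      simp only [word, cons.injEq] at h
      obtain ⟨rfl, h⟩ := h
      rw [append_cons_inj_of_notMem] at h
      · rw [hl ht.2.1 ht'.2.1 h.1, hr ht.2.2.1 ht'.2.2.1 h.2.2]
      · rw [mem_word]; exact ht.1.1
      · rw [mem_word]; exact ht.1.2

theorem Noncrossing.cons_append_cons {u w : List α} {c : α} (hu : Noncrossing u)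
    (hw : Noncrossing w) (hcu : c ∉ u) (hcw : c ∉ w) (hd : ∀ x ∈ u, x ∉ w) :
    Noncrossing (c :: (u ++ c :: w)) := by
  intro a b hab hs
  have hu := hu a b hab
  have hw := hw a b hab
  rw [sublist_cons_iff] at hs
  simp only [sublist_append_iff, sublist_cons_iff (l' := w)] at hs
  rcases hs with ⟨s, s', h, h₁, h₂⟩ | ⟨r, h, s, s', rfl, h₁, h₂⟩ <;>
    rcases h₂ with h₂ | ⟨s', rfl, h₂⟩ <;>
    have m₁ := h₁.subset <;> have m₂ : ∀ x ∈ s', x ∈ w := fun x hx => h₂.subset hx <;>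
    rcases s with _ | ⟨x₀, _ | ⟨x₁, _ | ⟨x₂, _ | ⟨x₃, s⟩⟩⟩⟩ <;>
    simp at h m₁ <;> grind only [= mem_cons]

theorem noncrossing_word {t : BinaryTree α} (ht : (labels t).Nodup) : Noncrossing (word t) := by
  induction t with
  | nil => simp [Noncrossing, word]
  | node c l r hl hr =>
    simp only [labels, nodup_cons, mem_append, not_or, nodup_append] at ht
    obtain ⟨⟨hcl, hcr⟩, hnl, hnr, hd⟩ := ht
    simp only [← mem_word] at hcl hcr hd
    exact (hl hnl).cons_append_cons (hr hnr) hcl hcr fun x hx hx' => hd x hx x hx' rfl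

theorem exists_word_eq [DecidableEq α] (l : List α) (hc : ∀ a ∈ l, l.count a = 2)
    (hn : Noncrossing l) : ∃ t, (labels t).Nodup ∧ word t = l := by
  induction hk : l.length using Nat.strong_induction_on generalizing l with
  | _ k ih =>
  cases l with
  | nil => exact ⟨.nil, by simp [labels], rfl⟩
  | cons a l =>
    have ha := hc a (by simp)
    simp only [count_cons_self, Nat.reduceEqDiff] at ha
    obtain ⟨u, w, rfl, hau⟩ := eq_append_cons_of_mem (count_pos_iff.1 (by omega : 0 < l.count a))
    have haw : a ∉ w := by
      rw [← count_eq_zero]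
      simpa [count_eq_zero_of_not_mem hau] using ha
    have hd : ∀ b ∈ u, b ∉ w := by
      intro b hbu hbw
      refine hn a b (by rintro rfl; exact hau hbu) ?_
      exact ((singleton_sublist.2 hbu).append ((singleton_sublist.2 hbw).cons_cons a)).cons_cons a
    obtain ⟨t, ht, htu⟩ := ih u.length (by simp at hk; omega) u (by
      intro b hb
      have h := hc b (by simp [hb])
      have hab : a ≠ b := by rintro rfl; exact hau hb
      simpa [count_cons, hab, count_eq_zero_of_not_mem (hd b hb)] using h)
      (hn.of_sublist (by simp)) rfl
    obtain ⟨s, hs, hsw⟩ := ih w.length (by simp at hk; omega) w (by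
      intro b hb
      have h := hc b (by simp [hb])
      have hab : a ≠ b := by rintro rfl; exact haw hb
      have hbu : b ∉ u := fun hbu => hd b hbu hb
      simpa [count_cons, hab, count_eq_zero_of_not_mem hbu] using h)
      (hn.of_sublist
        (((sublist_cons_self a w).trans (sublist_append_right u _)).trans (sublist_cons_self a _)))
      rfl
    refine ⟨.node a t s, ?_, by simp [word, htu, hsw]⟩
    subst htu hsw
    simp only [labels, nodup_cons, mem_append, nodup_append, ← mem_word]
    exact ⟨by tauto, ht, hs, fun b hb c hc hbc => hd b hb (hbc ▸ hc)⟩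

theorem length_labels (t : BinaryTree α) : (labels t).length = t.numNodes := by
  induction t with
  | nil => rfl
  | node a l r hl hr => simp [labels, hl, hr]

theorem numNodes_map {β : Type*} (f : α → β) (t : BinaryTree α) :
    (t.map f).numNodes = t.numNodes := by
  induction t with
  | nil => rfl
  | node a l r hl hr => simp [BinaryTree.map, hl, hr]

theorem eq_of_map_eq_of_labels_eq {t t' : BinaryTree α}
    (hs : t.map (fun _ => ()) = t'.map (fun _ => ())) (hl : labels t = labels t') : t = t' := by
  induction t generalizing t' with
  | nil => cases t' <;> simp_all [BinaryTree.map]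
  | node a l r ihl ihr =>
    cases t' with
    | nil => simp [BinaryTree.map] at hs
    | node a' l' r' =>
      simp only [BinaryTree.map, BinaryTree.node.injEq, true_and] at hs
      simp only [labels, cons.injEq] at hl
      obtain ⟨rfl, hl⟩ := hl
      have := append_inj hl (by
        rw [length_labels, length_labels, ← numNodes_map (fun _ => ()), hs.1, numNodes_map])
      rw [ihl hs.1 this.1, ihr hs.2 this.2]

theorem exists_map_eq_labels_eq (s : BinaryTree Unit) (p : List α) (h : p.length = s.numNodes) :
    ∃ t : BinaryTree α, t.map (fun _ => ()) = s ∧ labels t = p := by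
  induction s generalizing p with
  | nil => exact ⟨.nil, rfl, by simpa [labels, eq_comm] using h⟩
  | node x l r hl hr =>
    cases p with
    | nil => simp at h
    | cons a p =>
      simp at h
      obtain ⟨t, ht, htp⟩ := hl (p.take l.numNodes) (by simp; omega)
      obtain ⟨t', ht', htp'⟩ := hr (p.drop l.numNodes) (by simp; omega)
      exact ⟨.node a t t', by simp [BinaryTree.map, ht, ht'], by simp [labels, htp, htp']⟩

theorem card_perm_of_nodup {p : List α} (hp : p.Nodup) :
    Nat.card {q : List α // q ~ p} = p.length.factorial := by
  classical
  rw [Nat.subtype_card p.permutations.toFinset (by simp), toFinset_card_of_nodup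
    (nodup_permutations p hp), length_permutations]

/-- The number of labelled binary trees whose labels rearrange a given duplicate-free list. -/
theorem card_labels_perm {p : List α} (hp : p.Nodup) :
    Nat.card {t : BinaryTree α // labels t ~ p} = p.length.factorial * catalan p.length := by
  rw [← card_perm_of_nodup hp, ← BinaryTree.treesOfNumNodesEq_card_eq_catalan,
    ← Nat.card_eq_finsetCard, ← Nat.card_prod]
  refine Nat.card_eq_of_bijective (fun t => (⟨labels t.1, t.2⟩, ⟨t.1.map fun _ => (), ?_⟩)) ⟨?_, ?_⟩
  · rw [BinaryTree.mem_treesOfNumNodesEq, numNodes_map, ← length_labels, t.2.length_eq]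
  · rintro ⟨t, ht⟩ ⟨t', ht'⟩ h
    simp only [Prod.mk.injEq, Subtype.mk.injEq] at h
    exact Subtype.ext (eq_of_map_eq_of_labels_eq h.2 h.1)
  · rintro ⟨⟨q, hq⟩, ⟨s, hs⟩⟩
    rw [BinaryTree.mem_treesOfNumNodesEq] at hs
    obtain ⟨t, rfl, rfl⟩ := exists_map_eq_labels_eq s q (by rw [hs, hq.length_eq])
    exact ⟨⟨t, hq⟩, rfl⟩

theorem isMultisetPerm_iff {n : ℕ} {π : Fin (2 * n) → Fin n} :
    IsMultisetPerm n π ↔ ∀ v, (ofFn π).count v = 2 := by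
  refine forall_congr' fun v => ?_
  rw [← Multiset.coe_count, ← Fin.univ_val_map, Multiset.count_map, Nat.card_eq_fintype_card,
    Fintype.card_subtype, Finset.card_def, Finset.filter_val]
  simp only [eq_comm]

theorem noncrossing_ofFn_iff {n : ℕ} {π : Fin n → α} :
    Noncrossing (ofFn π) ↔ ∀ i j k l : Fin n, i < j → j < k → k < l →
      π i = π k → π j = π l → π i = π j := by
  constructor
  · intro h i j k l hij hjk hkl hik hjl
    by_contra hne
    refine h _ _ hne ?_
    have h4 : [π i, π j, π i, π j] = [i, j, k, l].map π := by simp [hik, hjl]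
    rw [h4, ofFn_eq_map]
    refine Sublist.map _ (sublist_of_subperm_of_pairwise (r := (· < ·)) ?_ ?_
      (pairwise_lt_finRange n))
    · refine subperm_of_subset ?_ fun x _ => mem_finRange x
      simp
      omega
    · simp
      omega
  · intro h a b hab hs
    obtain ⟨f, hf⟩ := sublist_iff_exists_fin_orderEmbedding_get_eq.1 hs
    have hf' (x : Fin 4) : [a, b, a, b].get x = π ((f x).cast length_ofFn) := by
      rw [hf, get_ofFn]
    have hlt {x y : Fin 4} (hxy : x < y) :
        (f x).cast (length_ofFn (f := π)) < (f y).cast (length_ofFn (f := π)) :=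
      f.strictMono hxy
    have h01 := h _ _ _ _ (hlt (x := 0) (y := 1) (by decide)) (hlt (y := 2) (by decide))
      (hlt (y := 3) (by decide)) ((hf' 0).symm.trans (hf' 2)) ((hf' 1).symm.trans (hf' 3))
    exact hab ((hf' 0).trans (h01.trans (hf' 1).symm))

theorem isQuasiStirling_iff {n : ℕ} {π : Fin (2 * n) → Fin n} :
    IsQuasiStirling n π ↔ (∀ v, (ofFn π).count v = 2) ∧ Noncrossing (ofFn π) := by
  rw [IsQuasiStirling, isMultisetPerm_iff, noncrossing_ofFn_iff]
  refine and_congr_right fun _ => ?_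
  constructor
  · rintro ⟨h₁, h₂⟩ i j k l hij hjk hkl hik hjl
    by_contra hne
    rcases lt_or_gt_of_ne hne with h | h
    · exact h₁ ⟨i, j, k, l, hij, hjk, hkl, hik, hjl, h⟩
    · exact h₂ ⟨i, j, k, l, hij, hjk, hkl, hik, hjl, h⟩
  · intro h
    constructor
    · rintro ⟨i, j, k, l, hij, hjk, hkl, hik, hjl, hlt⟩
      exact hlt.ne (h i j k l hij hjk hkl hik hjl)
    · rintro ⟨i, j, k, l, hij, hjk, hkl, hik, hjl, hlt⟩
      exact hlt.ne' (h i j k l hij hjk hkl hik hjl)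

end QuasiStirling

open QuasiStirling

theorem quasiStirling_count (n : ℕ) (hn : 1 ≤ n) :
    Nat.card {π : Fin (2 * n) → Fin n // IsQuasiStirling n π} =
      Nat.factorial n * catalan n := by
  have hcard := card_labels_perm (List.nodup_finRange n)
  rw [List.length_finRange] at hcard
  rw [← hcard]
  have hcount (v : Fin n) : (List.finRange n).count v = 1 :=
    List.count_eq_one_of_mem (List.nodup_finRange n) (List.mem_finRange v)
  have hlen (t : {t : BinaryTree (Fin n) // (labels t).Perm (List.finRange n)}) :
      (word t.1).length = 2 * n := by
    rw [length_word, t.2.length_eq, List.length_finRange]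
  have hofFn (t : {t : BinaryTree (Fin n) // (labels t).Perm (List.finRange n)}) :
      List.ofFn (fun i => (word t.1).get (i.cast (hlen t).symm)) = word t.1 := by
    rw [← List.ofFn_congr (hlen t) (word t.1).get, List.ofFn_get]
  symm
  refine Nat.card_eq_of_bijective
    (fun t => ⟨fun i => (word t.1).get (i.cast (hlen t).symm), ?_⟩) ⟨?_, ?_⟩
  · rw [isQuasiStirling_iff, hofFn]
    refine ⟨fun v => ?_, noncrossing_word (t.2.nodup_iff.2 (List.nodup_finRange n))⟩
    rw [count_word, t.2.count_eq, hcount]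
  · intro t t' h
    have h := congrArg List.ofFn (Subtype.mk.inj h)
    rw [hofFn, hofFn] at h
    exact Subtype.ext (eq_of_word_eq (t.2.nodup_iff.2 (List.nodup_finRange n))
      (t'.2.nodup_iff.2 (List.nodup_finRange n)) h)
  · rintro ⟨π, hπ⟩
    obtain ⟨hc, hnc⟩ := isQuasiStirling_iff.1 hπ
    obtain ⟨t, -, htw⟩ := exists_word_eq (List.ofFn π) (fun a _ => hc a) hnc
    have ht : (labels t).Perm (List.finRange n) := by
      rw [List.perm_iff_count]
      intro v
      have := count_word t v
      rw [htw, hc] at this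
      rw [hcount]
      omega
    refine ⟨⟨t, ht⟩, Subtype.ext (List.ofFn_injective ?_)⟩
    rw [hofFn ⟨t, ht⟩, htw]
end

section
/- For every n ≥ 2, the number of quasi-Stirling permutations of the multiset [n,n] that avoid both patterns 132 and 312 equals 4 · 3^{n−2}. -/
/-- Lists in which each integer of `[lo, hi]` occurs exactly twice and no other integer occurs,
without crossing pairs, and in which no entry lies strictly between two earlier ones. -/
def IsGoodWord (lo hi : ℤ) (l : List ℤ) : Prop :=
  (∀ v, l.count v = if lo ≤ v ∧ v ≤ hi then 2 else 0) ∧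
  (∀ x y, x ≠ y → ¬ [x, y, x, y].Sublist l) ∧
  ∀ x y z, x < z → z < y → ¬ [x, y, z].Sublist l ∧ ¬ [y, x, z].Sublist l

/-- The good words on `[lo, hi]`. -/
def goodWords (lo hi : ℤ) : Set (List ℤ) := {l | IsGoodWord lo hi l}

/-- The good words on `[lo, hi]` with last letter `hi`, that letter being removed. -/
def topWords (lo hi : ℤ) : Set (List ℤ) := {l | IsGoodWord lo hi (l ++ [hi])}

theorem pair_sublist_of_mem {l : List ℤ} {x y : ℤ} (hx : x ∈ l) (hy : y ∈ l) (hxy : x ≠ y) :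
    [x, y].Sublist l ∨ [y, x].Sublist l := by
  obtain ⟨s, t, rfl⟩ := List.append_of_mem hx
  simp only [List.mem_append, List.mem_cons] at hy
  rcases hy with hy | hy | hy
  · right
    exact (List.singleton_sublist.2 hy).append (by simp : [x].Sublist (x :: t))
  · exact absurd hy.symm hxy
  · left
    exact ((List.singleton_sublist.2 hy).cons_cons x).trans (List.sublist_append_right _ _)

theorem sublist_of_sublist_append {k l r : List ℤ} {z : ℤ} (h : (k ++ [z]).Sublist (l ++ r))
    (hz : z ∉ r) : (k ++ [z]).Sublist l := by
  obtain ⟨a, b, hab, ha, hb⟩ := List.sublist_append_iff.1 h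
  rcases List.eq_nil_or_concat' b with rfl | ⟨b, y, rfl⟩
  · rw [List.append_nil] at hab
    rwa [hab]
  · rw [← List.append_assoc] at hab
    have := (List.append_inj' hab rfl).2
    simp only [List.cons.injEq, and_true] at this
    exact absurd (hb.subset (by simp [this])) hz

theorem sublist_of_sublist_append_pair {k l r : List ℤ} {a : ℤ}
    (h : k.Sublist (l ++ [a, a] ++ r)) (ha : a ∉ k) : k.Sublist (l ++ r) := by
  have hk : k.filter (· ≠ a) = k := by
    rw [List.filter_eq_self]
    intro b hb
    simpa using fun hba : b = a => ha (hba ▸ hb)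
  have := h.filter (· ≠ a)
  rw [hk] at this
  refine this.trans ?_
  simpa using List.filter_sublist (p := fun b => !decide (b = a)) (l := l ++ r)

namespace IsGoodWord

variable {lo hi : ℤ} {l : List ℤ}

theorem mem_iff (h : IsGoodWord lo hi l) (v : ℤ) : v ∈ l ↔ lo ≤ v ∧ v ≤ hi := by
  rw [← List.count_pos_iff, h.1]
  split_ifs <;> simp_all

theorem of_sublist {lo' hi' : ℤ} {l' : List ℤ} (h : IsGoodWord lo hi l) (hs : l'.Sublist l)
    (hc : ∀ v, l'.count v = if lo' ≤ v ∧ v ≤ hi' then 2 else 0) : IsGoodWord lo' hi' l' :=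
  ⟨hc, fun x y hxy h' => h.2.1 x y hxy (h'.trans hs),
    fun x y z h1 h2 => ⟨fun h' => (h.2.2 x y z h1 h2).1 (h'.trans hs),
      fun h' => (h.2.2 x y z h1 h2).2 (h'.trans hs)⟩⟩

theorem neg (h : IsGoodWord lo hi l) : IsGoodWord (-hi) (-lo) (l.map Neg.neg) := by
  have key : ∀ k : List ℤ, k.Sublist (l.map Neg.neg) → (k.map Neg.neg).Sublist l := by
    intro k hk
    simpa using hk.map Neg.neg
  refine ⟨fun v => ?_, fun x y hxy hs => ?_, fun x y z hxz hzy => ⟨fun hs => ?_, fun hs => ?_⟩⟩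
  · have := List.count_map_of_injective l Neg.neg neg_injective (-v)
    rw [neg_neg] at this
    rw [this, h.1]
    congr 1
    apply propext
    constructor <;> rintro ⟨h1, h2⟩ <;> constructor <;> omega
  · exact h.2.1 (-x) (-y) (by simpa using hxy) (by simpa using key _ hs)
  · exact (h.2.2 (-y) (-x) (-z) (by omega) (by omega)).2 (by simpa using key _ hs)
  · exact (h.2.2 (-y) (-x) (-z) (by omega) (by omega)).1 (by simpa using key _ hs)

/-- An entry preceded by both `lo` and `hi` is one of them. -/
theorem eq_or_eq_of_mem_left {p s : List ℤ} {z : ℤ} (h : IsGoodWord lo hi (p ++ z :: s))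
    (hlo : lo ∈ p) (hhi : hi ∈ p) : z = lo ∨ z = hi := by
  by_contra! hz
  have hm := (h.mem_iff z).1 (by simp)
  have hlt : lo < z := lt_of_le_of_ne hm.1 (Ne.symm hz.1)
  have hgt : z < hi := lt_of_le_of_ne hm.2 hz.2
  have hz' : [z].Sublist (z :: s) := by simp
  rcases pair_sublist_of_mem hlo hhi (by omega) with hs | hs
  · exact (h.2.2 _ _ _ hlt hgt).1 (hs.append hz')
  · exact (h.2.2 _ _ _ hlt hgt).2 (hs.append hz')

theorem last_eq {z : ℤ} (hlt : lo < hi) (h : IsGoodWord lo hi (l ++ [z])) : z = lo ∨ z = hi := by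
  by_contra! hz
  have h1 : lo ∈ l := by
    have := (h.mem_iff lo).2 ⟨le_rfl, hlt.le⟩
    simpa [Ne.symm hz.1] using this
  have h2 : hi ∈ l := by
    have := (h.mem_iff hi).2 ⟨hlt.le, le_rfl⟩
    simpa [Ne.symm hz.2] using this
  exact (not_or.2 hz) (h.eq_or_eq_of_mem_left h1 h2)

theorem append_top (h : IsGoodWord lo (hi - 1) l) (hle : lo ≤ hi) :
    IsGoodWord lo hi (l ++ [hi, hi]) := by
  have hm : ∀ v ∈ l, v < hi := fun v hv => by have := (h.mem_iff v).1 hv; omega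
  have hl : hi ∉ l := fun hv => lt_irrefl _ (hm _ hv)
  refine ⟨fun v => ?_, fun x y hxy hs => ?_, fun x y z hxz hzy => ?_⟩
  · rw [List.count_append, h.1]
    by_cases hv : v = hi
    · subst hv; simp [hle]
    · have : List.count v [hi, hi] = 0 := by simp [List.count_eq_zero, hv]
      rw [this]
      split_ifs <;> omega
  · by_cases hy : y = hi
    · subst hy
      have h3 : [x, y, x].Sublist (l ++ [y, y]) := (List.sublist_append_left _ [y]).trans hs
      exact hl ((sublist_of_sublist_append (k := [x, y]) h3 (by simpa using hxy)).subset (by simp))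
    · exact h.2.1 x y hxy (sublist_of_sublist_append (k := [x, y, x]) hs (by simpa using hy))
  · have hy : ∀ k : List ℤ, k.Sublist (l ++ [hi, hi]) → y ∈ k → z ≠ hi := by
      intro k hk hyk
      have := hk.subset hyk
      simp only [List.mem_append, List.mem_cons, List.not_mem_nil, or_false, or_self] at this
      rcases this with h' | h'
      · have := hm _ h'
        omega
      · omega
    refine ⟨fun hs => (h.2.2 x y z hxz hzy).1 ?_, fun hs => (h.2.2 x y z hxz hzy).2 ?_⟩
    · exact sublist_of_sublist_append (k := [x, y]) hs (by simpa using hy _ hs (by simp))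
    · exact sublist_of_sublist_append (k := [y, x]) hs (by simpa using hy _ hs (by simp))

theorem insert_bottom (h : IsGoodWord (lo + 1) hi (l ++ [hi])) (hlt : lo < hi) :
    IsGoodWord lo hi (l ++ [lo, lo] ++ [hi]) := by
  have hl : lo ∉ l := fun hv => by
    have := (h.mem_iff lo).1 (by simp [hv])
    omega
  have hm : ∀ v ∈ l ++ [lo, lo] ++ [hi], lo ≤ v ∧ v ≤ hi := by
    intro v hv
    by_cases hv' : v = lo
    · omega
    · have := (h.mem_iff v).1 (by simpa [hv'] using hv)
      omega
  refine ⟨fun v => ?_, fun x y hxy hs => ?_, fun x y z hxz hzy => ?_⟩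
  · have := h.1 v
    by_cases hv : v = lo
    · subst hv
      simp [List.count_eq_zero.2 hl, hlt.ne', hlt.le]
    · simp only [List.count_append] at this ⊢
      rw [List.count_eq_zero.2 (show v ∉ [lo, lo] by simpa using hv), add_zero, this]
      split_ifs <;> omega
  · by_cases hy : y = lo
    · subst hy
      have h4 := sublist_of_sublist_append (k := [x, y, x]) hs (by simpa using hlt.ne)
      have h3 : [x, y, x].Sublist (l ++ [y, y]) := (List.sublist_append_left _ [y]).trans h4
      exact hl ((sublist_of_sublist_append (k := [x, y]) h3 (by simpa using hxy)).subset (by simp))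
    by_cases hx : x = lo
    · subst hx
      have h3 : [x, y, x].Sublist (l ++ [x, x]) := by
        by_cases hyh : y = hi
        · subst hyh
          exact (List.append_sublist_append_right (l₁ := [x, y, x]) [y]).1 hs
        · exact (List.sublist_append_left _ [y]).trans
            (sublist_of_sublist_append (k := [x, y, x]) hs (by simpa using hyh))
      have h2 : [x, y].Sublist (l ++ [x, x]) := (List.sublist_append_left _ [x]).trans h3
      exact hl ((sublist_of_sublist_append (k := [x]) h2 (by simpa using hy)).subset (by simp))
    · exact h.2.1 x y hxy (sublist_of_sublist_append_pair hs (by simp [Ne.symm hx, Ne.symm hy]))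
  · have key : ∀ k : List ℤ, (k ++ [z]).Sublist (l ++ [lo, lo] ++ [hi]) → x ∈ k → y ∈ k →
        (∀ v ∈ k, v = x ∨ v = y) → (k ++ [z]).Sublist (l ++ [hi]) := by
      intro k hk hxk hyk hv
      have hxm := hm x (hk.subset (by simp [hxk]))
      have hym := hm y (hk.subset (by simp [hyk]))
      by_cases hx : x = lo
      · have h1 := sublist_of_sublist_append hk (by simp; omega)
        have h2 := sublist_of_sublist_append h1 (by simp; omega)
        exact absurd (h2.subset (by simp [← hx, hxk])) hl
      · refine sublist_of_sublist_append_pair hk ?_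
        simp only [List.mem_append, List.mem_singleton, not_or]
        refine ⟨fun hlk => ?_, by omega⟩
        have := hv _ hlk
        omega
    exact ⟨fun hs => (h.2.2 x y z hxz hzy).1 (key [x, y] hs (by simp) (by simp) (by simp)),
      fun hs => (h.2.2 x y z hxz hzy).2
        (key [y, x] hs (by simp) (by simp) (by simp [or_comm]))⟩

theorem top_cases (h : IsGoodWord lo hi (l ++ [hi])) (hlt : lo < hi) :
    (∃ k, IsGoodWord lo (hi - 1) k ∧ l = k ++ [hi]) ∨
      ∃ k, IsGoodWord (lo + 1) hi (k ++ [hi]) ∧ l = k ++ [lo, lo] := by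
  have hch := h.1 hi
  have hcl := h.1 lo
  simp only [List.count_append, List.count_singleton_self, hlt.le, le_refl, and_self, if_true]
    at hch hcl
  rw [List.count_eq_zero.2 (show lo ∉ [hi] by simpa using hlt.ne)] at hcl
  rcases List.eq_nil_or_concat' l with rfl | ⟨p, z, rfl⟩
  · simp at hch
  by_cases hz : z = hi
  · subst hz
    refine Or.inl ⟨p, h.of_sublist (by simp) fun v => ?_, rfl⟩
    have := h.1 v
    by_cases hv : v = z
    · subst hv
      rw [List.count_append] at hch
      simp at hch
      simp [hch]
    · simp only [List.count_append, List.count_singleton] at this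
      simp [Ne.symm hv] at this
      rw [this]
      split_ifs <;> omega
  · right
    have hhp : hi ∈ p := by
      rw [← List.count_pos_iff]
      rw [List.count_append, List.count_eq_zero.2 (show hi ∉ [z] by simpa using Ne.symm hz)] at hch
      omega
    have hzl : z = lo := by
      by_contra hzl
      have hlp : lo ∈ p := by
        rw [← List.count_pos_iff]
        rw [List.count_append,
          List.count_eq_zero.2 (show lo ∉ [z] by simpa using Ne.symm hzl)] at hcl
        omega
      rw [List.append_assoc] at h
      exact (h.eq_or_eq_of_mem_left hlp hhp).elim hzl hz
    subst hzl
    rw [List.count_append, List.count_singleton_self] at hcl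
    rcases List.eq_nil_or_concat' p with rfl | ⟨q, y, rfl⟩
    · simp at hcl
    have hyl : y = z := by
      by_contra hyl
      have hlq : z ∈ q := by
        rw [← List.count_pos_iff]
        rw [List.count_append,
          List.count_eq_zero.2 (show z ∉ [y] by simpa using Ne.symm hyl)] at hcl
        omega
      by_cases hyh : y = hi
      · subst hyh
        refine h.2.1 z y (by omega) ?_
        have hs : [z].Sublist q := by simpa using hlq
        simpa using hs.append_right [y, z, y]
      · have hhq : hi ∈ q := by simpa [Ne.symm hyh] using hhp
        rw [List.append_assoc, List.append_assoc] at h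
        exact (h.eq_or_eq_of_mem_left hlq hhq).elim hyl hyh
    subst hyl
    refine ⟨q, h.of_sublist (by simp) fun v => ?_, by simp⟩
    have := h.1 v
    by_cases hv : v = y
    · subst hv
      rw [List.count_append] at hcl
      simp at hcl
      simp [hcl, hlt.ne']
    · simp only [List.count_append, List.count_singleton] at this ⊢
      simp [Ne.symm hv] at this ⊢
      rw [this]
      split_ifs <;> omega

end IsGoodWord

theorem isGoodWord_self_iff (a : ℤ) (l : List ℤ) : IsGoodWord a a l ↔ l = [a, a] := by
  constructor
  · intro h
    have hp : l.Perm (List.replicate 2 a) := by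
      rw [List.perm_iff_count]
      intro v
      rw [h.1, List.count_replicate]
      simp only [beq_iff_eq]
      congr 1
      apply propext
      omega
    exact List.perm_replicate.1 hp
  · rintro rfl
    refine ⟨fun v => ?_, fun x y _ hs => ?_, fun x y z _ _ => ⟨fun hs => ?_, fun hs => ?_⟩⟩
    · by_cases hv : v = a
      · simp [hv]
      · rw [List.count_eq_zero.2 (by simpa using hv), if_neg (by omega)]
    all_goals exact absurd hs.length_le (by simp)

theorem encard_goodWords_self (a : ℤ) : (goodWords a a).encard = 1 := by
  have : goodWords a a = {[a, a]} := Set.ext fun l => isGoodWord_self_iff a l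
  rw [this, Set.encard_singleton]

theorem encard_topWords_self (a : ℤ) : (topWords a a).encard = 1 := by
  have : topWords a a = {[a]} := by
    ext l
    refine (isGoodWord_self_iff a _).trans ?_
    rw [show [a, a] = [a] ++ [a] from rfl, List.append_left_inj]
    rfl
  rw [this, Set.encard_singleton]

theorem encard_goodWords {lo hi : ℤ} (hlt : lo < hi) :
    (goodWords lo hi).encard = (topWords lo hi).encard + (topWords (-hi) (-lo)).encard := by
  have hneg : Function.Injective (List.map (Neg.neg : ℤ → ℤ)) :=
    List.map_injective_iff.2 neg_injective
  have happ (a : ℤ) : Function.Injective (· ++ [a]) := List.append_left_injective [a]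
  have : goodWords lo hi = (· ++ [hi]) '' topWords lo hi ∪
      (fun l => l.map Neg.neg ++ [lo]) '' topWords (-hi) (-lo) := by
    ext l
    constructor
    · intro h
      rcases List.eq_nil_or_concat' l with rfl | ⟨p, z, rfl⟩
      · exact absurd ((IsGoodWord.mem_iff h lo).2 ⟨le_rfl, hlt.le⟩) (by simp)
      rcases IsGoodWord.last_eq hlt h with rfl | rfl
      · exact Or.inr ⟨p.map Neg.neg, by simpa [topWords] using IsGoodWord.neg h, by simp⟩
      · exact Or.inl ⟨p, h, rfl⟩
    · rintro (⟨p, hp, rfl⟩ | ⟨p, hp, rfl⟩)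
      · exact hp
      · simpa [goodWords] using IsGoodWord.neg hp
  have hinj : Function.Injective fun l : List ℤ => l.map Neg.neg ++ [lo] := (happ lo).comp hneg
  rw [this, Set.encard_union_eq, (happ hi).encard_image, hinj.encard_image]
  rw [Set.disjoint_left]
  rintro _ ⟨p, _, rfl⟩ ⟨q, _, hq⟩
  have := (List.append_inj' hq rfl).2
  simp [hlt.ne] at this

theorem encard_topWords {lo hi : ℤ} (hlt : lo < hi) :
    (topWords lo hi).encard =
      (goodWords lo (hi - 1)).encard + (topWords (lo + 1) hi).encard := by
  have : topWords lo hi = (· ++ [hi]) '' goodWords lo (hi - 1) ∪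
      (· ++ [lo, lo]) '' topWords (lo + 1) hi := by
    ext l
    constructor
    · intro h
      rcases IsGoodWord.top_cases h hlt with ⟨k, hk, rfl⟩ | ⟨k, hk, rfl⟩
      · exact Or.inl ⟨k, hk, rfl⟩
      · exact Or.inr ⟨k, hk, rfl⟩
    · rintro (⟨k, hk, rfl⟩ | ⟨k, hk, rfl⟩)
      · simpa [topWords] using IsGoodWord.append_top hk hlt.le
      · exact IsGoodWord.insert_bottom hk hlt
  rw [this, Set.encard_union_eq, (List.append_left_injective _).encard_image,
    (List.append_left_injective _).encard_image]
  rw [Set.disjoint_left]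
  rintro _ ⟨p, _, rfl⟩ ⟨q, _, hq⟩
  have := congrArg List.getLast? hq
  simp [hlt.ne] at this

theorem encard_topWords_eq (m : ℕ) (lo hi : ℤ) (h : hi = lo + m + 1) :
    (topWords lo hi).encard = 2 * 3 ^ m := by
  induction m generalizing lo hi with
  | zero =>
    rw [encard_topWords (by omega), show hi - 1 = lo by simp [h], show lo + 1 = hi by simp [h],
      encard_goodWords_self, encard_topWords_self]
    norm_num
  | succ m ih =>
    push_cast at h
    rw [encard_topWords (by omega), encard_goodWords (by omega), ih _ _ (by omega),
      ih _ _ (by omega), ih _ _ (by omega)]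
    ring

theorem encard_goodWords_eq (m : ℕ) (lo hi : ℤ) (h : hi = lo + m + 1) :
    (goodWords lo hi).encard = 4 * 3 ^ m := by
  rw [encard_goodWords (by omega), encard_topWords_eq m _ _ h,
    encard_topWords_eq m _ _ (by omega)]
  ring

theorem sublist_ofFn_iff {α : Type*} {N : ℕ} (k : List α) (g : Fin N → α) :
    k.Sublist (List.ofFn g) ↔
      ∃ f : Fin k.length → Fin N, StrictMono f ∧ ∀ i, k.get i = g (f i) := by
  rw [List.sublist_iff_exists_fin_orderEmbedding_get_eq]
  constructor
  · rintro ⟨f, hf⟩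
    refine ⟨fun i => (f i).cast (by simp), fun i j hij => f.strictMono hij, fun i => ?_⟩
    rw [hf i, List.get_ofFn]
  · rintro ⟨f, hf, hg⟩
    refine ⟨OrderEmbedding.ofStrictMono (fun i => (f i).cast (by simp)) fun i j hij => hf hij,
      fun i => ?_⟩
    rw [hg i, List.get_ofFn]
    rfl

theorem triple_sublist_ofFn_iff {α : Type*} {N : ℕ} (x y z : α) (g : Fin N → α) :
    [x, y, z].Sublist (List.ofFn g) ↔
      ∃ i j k, i < j ∧ j < k ∧ x = g i ∧ y = g j ∧ z = g k := by
  rw [sublist_ofFn_iff]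
  constructor
  · rintro ⟨f, hf, hg⟩
    exact ⟨f 0, f 1, f 2, hf (show (0 : Fin 3) < 1 by decide), hf (show (1 : Fin 3) < 2 by decide),
      hg 0, hg 1, hg 2⟩
  · rintro ⟨i, j, k, hij, hjk, rfl, rfl, rfl⟩
    refine ⟨![i, j, k], ?_, ?_⟩
    · rw [Fin.strictMono_iff_lt_succ (n := 2)]
      intro a
      fin_cases a <;> simpa
    · intro a
      change Fin 3 at a
      fin_cases a <;> rfl

theorem quadruple_sublist_ofFn_iff {α : Type*} {N : ℕ} (x y z w : α) (g : Fin N → α) :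
    [x, y, z, w].Sublist (List.ofFn g) ↔
      ∃ i j k l, i < j ∧ j < k ∧ k < l ∧ x = g i ∧ y = g j ∧ z = g k ∧ w = g l := by
  rw [sublist_ofFn_iff]
  constructor
  · rintro ⟨f, hf, hg⟩
    exact ⟨f 0, f 1, f 2, f 3, hf (show (0 : Fin 4) < 1 by decide),
      hf (show (1 : Fin 4) < 2 by decide),
      hf (show (2 : Fin 4) < 3 by decide),
      hg 0, hg 1, hg 2, hg 3⟩
  · rintro ⟨i, j, k, l, hij, hjk, hkl, rfl, rfl, rfl, rfl⟩
    refine ⟨![i, j, k, l], ?_, ?_⟩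
    · rw [Fin.strictMono_iff_lt_succ (n := 3)]
      intro a
      fin_cases a <;> simpa
    · intro a
      change Fin 4 at a
      fin_cases a <;> rfl

theorem count_ofFn {α : Type*} [DecidableEq α] {N : ℕ} (g : Fin N → α) (v : α) :
    (List.ofFn g).count v = Nat.card {i // g i = v} := by
  rw [Nat.card_eq_fintype_card, Fintype.card_subtype]
  induction N with
  | zero => simp
  | succ N ih =>
    rw [List.ofFn_succ, List.count_cons, ih, Fin.card_filter_univ_succ]
    by_cases h : g 0 = v <;> simp [h]

/-- A word on `Fin n` as a list of integers. -/
def toWord (n : ℕ) (π : Fin (2 * n) → Fin n) : List ℤ := List.ofFn fun i => ((π i : ℕ) : ℤ)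

theorem toWord_injective (n : ℕ) : Function.Injective (toWord n) := by
  intro π ρ h
  funext i
  have := congrFun (List.ofFn_injective h) i
  exact Fin.ext (by exact_mod_cast this)

theorem isMultisetPerm_iff (n : ℕ) (π : Fin (2 * n) → Fin n) :
    IsMultisetPerm n π ↔
      ∀ v, (toWord n π).count v = if 0 ≤ v ∧ v ≤ (n : ℤ) - 1 then 2 else 0 := by
  have key (v : Fin n) : (toWord n π).count ((v : ℕ) : ℤ) = Nat.card {i // π i = v} := by
    rw [toWord, count_ofFn]
    exact Nat.card_congr (Equiv.subtypeEquivRight fun i => by simp [Fin.ext_iff])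
  constructor
  · intro h v
    split_ifs with hv
    · obtain ⟨m, rfl⟩ := Int.eq_ofNat_of_zero_le hv.1
      exact (key ⟨m, by omega⟩).trans (h _)
    · rw [List.count_eq_zero, toWord, List.mem_ofFn]
      rintro ⟨i, rfl⟩
      have := (π i).isLt
      omega
  · intro h v
    rw [← key, h, if_pos]
    have := v.isLt
    omega

theorem avoids_crossing_iff (n : ℕ) (π : Fin (2 * n) → Fin n) :
    Avoids1212 n π ∧ Avoids2121 n π ↔
      ∀ x y, x ≠ y → ¬ [x, y, x, y].Sublist (toWord n π) := by
  simp only [toWord, quadruple_sublist_ofFn_iff]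
  constructor
  · rintro ⟨h1, h2⟩ _ _ hxy ⟨i, j, k, l, hij, hjk, hkl, rfl, rfl, hk, hl⟩
    have hk' : π i = π k := Fin.ext (by exact_mod_cast hk)
    have hl' : π j = π l := Fin.ext (by exact_mod_cast hl)
    rcases lt_trichotomy (π i) (π j) with h | h | h
    · exact h1 ⟨i, j, k, l, hij, hjk, hkl, hk', hl', h⟩
    · exact hxy (by rw [h])
    · exact h2 ⟨i, j, k, l, hij, hjk, hkl, hk', hl', h⟩
  · intro h
    constructor <;> rintro ⟨i, j, k, l, hij, hjk, hkl, hk, hl, hlt⟩ <;>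
      refine h (π i : ℕ) (π j : ℕ) ?_ ⟨i, j, k, l, hij, hjk, hkl, rfl, rfl, by rw [hk], by rw [hl]⟩
    · exact_mod_cast (Fin.lt_def.1 hlt).ne
    · exact_mod_cast (Fin.lt_def.1 hlt).ne'

theorem contains_132_iff (n : ℕ) (π : Fin (2 * n) → Fin n) :
    Contains3 n ![1, 3, 2] π ↔ ∃ i j k, i < j ∧ j < k ∧ π i < π k ∧ π k < π j := by
  constructor
  · rintro ⟨f, hf, h⟩
    exact ⟨f 0, f 1, f 2, hf (by decide), hf (by decide), (h 0 2).2 (by simp),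
      (h 2 1).2 (by simp)⟩
  · rintro ⟨i, j, k, hij, hjk, h1, h2⟩
    refine ⟨![i, j, k], ?_, ?_⟩
    · rw [Fin.strictMono_iff_lt_succ (n := 2)]
      intro a
      fin_cases a <;> simpa
    · intro a b
      fin_cases a <;> fin_cases b <;> simp [h1, h2, h1.le, h2.le, h1.trans h2, (h1.trans h2).le]

theorem contains_312_iff (n : ℕ) (π : Fin (2 * n) → Fin n) :
    Contains3 n ![3, 1, 2] π ↔ ∃ i j k, i < j ∧ j < k ∧ π j < π k ∧ π k < π i := by
  constructor
  · rintro ⟨f, hf, h⟩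
    exact ⟨f 0, f 1, f 2, hf (by decide), hf (by decide), (h 1 2).2 (by simp),
      (h 2 0).2 (by simp)⟩
  · rintro ⟨i, j, k, hij, hjk, h1, h2⟩
    refine ⟨![i, j, k], ?_, ?_⟩
    · rw [Fin.strictMono_iff_lt_succ (n := 2)]
      intro a
      fin_cases a <;> simpa
    · intro a b
      fin_cases a <;> fin_cases b <;> simp [h1, h2, h1.le, h2.le, h1.trans h2, (h1.trans h2).le]

theorem avoids_extremal_iff (n : ℕ) (π : Fin (2 * n) → Fin n) :
    Avoids3 n ![1, 3, 2] π ∧ Avoids3 n ![3, 1, 2] π ↔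
      ∀ x y z, x < z → z < y →
        ¬ [x, y, z].Sublist (toWord n π) ∧ ¬ [y, x, z].Sublist (toWord n π) := by
  simp only [Avoids3, contains_132_iff, contains_312_iff, toWord, triple_sublist_ofFn_iff]
  constructor
  · rintro ⟨h1, h2⟩ x y z hxz hzy
    constructor
    · rintro ⟨i, j, k, hij, hjk, rfl, rfl, rfl⟩
      exact h1 ⟨i, j, k, hij, hjk, by exact_mod_cast hxz, by exact_mod_cast hzy⟩
    · rintro ⟨i, j, k, hij, hjk, rfl, rfl, rfl⟩
      exact h2 ⟨i, j, k, hij, hjk, by exact_mod_cast hxz, by exact_mod_cast hzy⟩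
  · intro h
    constructor
    · rintro ⟨i, j, k, hij, hjk, h1, h2⟩
      exact (h (π i : ℕ) (π j : ℕ) (π k : ℕ) (by exact_mod_cast h1) (by exact_mod_cast h2)).1
        ⟨i, j, k, hij, hjk, rfl, rfl, rfl⟩
    · rintro ⟨i, j, k, hij, hjk, h1, h2⟩
      exact (h (π j : ℕ) (π i : ℕ) (π k : ℕ) (by exact_mod_cast h1) (by exact_mod_cast h2)).2
        ⟨i, j, k, hij, hjk, rfl, rfl, rfl⟩

theorem isGoodWord_toWord_iff (n : ℕ) (π : Fin (2 * n) → Fin n) :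
    IsGoodWord 0 (n - 1) (toWord n π) ↔
      IsQuasiStirling n π ∧ Avoids3 n ![1, 3, 2] π ∧ Avoids3 n ![3, 1, 2] π := by
  rw [IsQuasiStirling, isMultisetPerm_iff, avoids_crossing_iff, avoids_extremal_iff, and_assoc]
  rfl

theorem IsGoodWord.length_eq {n : ℕ} {l : List ℤ} (h : IsGoodWord 0 (n - 1) l) :
    l.length = 2 * n := by
  have hs : l.toFinset = Finset.Icc 0 ((n : ℤ) - 1) := by
    ext v
    rw [List.mem_toFinset, h.mem_iff, Finset.mem_Icc]
  rw [← List.sum_toFinset_count_eq_length, hs, Finset.sum_congr rfl (g := fun _ => 2)]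
  · simp [mul_comm]
  · intro v hv
    rw [h.1, if_pos (Finset.mem_Icc.1 hv)]

theorem image_toWord (n : ℕ) :
    toWord n '' {π | IsQuasiStirling n π ∧ Avoids3 n ![1, 3, 2] π ∧ Avoids3 n ![3, 1, 2] π} =
      goodWords 0 (n - 1) := by
  ext l
  constructor
  · rintro ⟨π, hπ, rfl⟩
    exact (isGoodWord_toWord_iff n π).2 hπ
  · intro h
    have hlen := IsGoodWord.length_eq h
    have hb (i : Fin (2 * n)) := (IsGoodWord.mem_iff h _).1 (List.get_mem l (i.cast hlen.symm))
    have hl : toWord n (fun i => ⟨(l.get (i.cast hlen.symm)).toNat, by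
        have := hb i
        omega⟩) = l := by
      refine List.ext_get (by simp [toWord, hlen]) fun i h1 h2 => ?_
      have := (hb ⟨i, by omega⟩).1
      simpa [toWord] using this
    refine ⟨_, (isGoodWord_toWord_iff n _).1 ?_, hl⟩
    rw [hl]
    exact h

theorem quasiStirling_avoiding_132_312 (n : ℕ) (hn : 2 ≤ n) :
    Nat.card {π : Fin (2 * n) → Fin n //
      IsQuasiStirling n π ∧ Avoids3 n ![1, 3, 2] π ∧ Avoids3 n ![3, 1, 2] π} =
      4 * 3 ^ (n - 2) := by
  have h := encard_goodWords_eq (n - 2) 0 (n - 1) (by omega)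
  rw [← image_toWord, (toWord_injective n).encard_image] at h
  have h' := congrArg ENat.toNat h
  rw [show (4 * 3 ^ (n - 2) : ℕ∞) = ((4 * 3 ^ (n - 2) : ℕ) : ℕ∞) by push_cast; rfl,
    ENat.toNat_natCast] at h'
  exact h'
end

section
/- For every n ≥ 2, the number of quasi-Stirling permutations of the multiset [n,n] that avoid both patterns 132 and 231 equals 4 · 3^{n−2}. -/
/-- A noncrossing arrangement of two copies of each value in which every entry with smaller
entries on both sides has equal smaller entries on both sides. -/
def IsNoncrossingValley (n : ℕ) (π : Fin (2 * n) → Fin n) : Prop :=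
  (∀ v, ∃ p q, p < q ∧ ∀ i, π i = v ↔ i = p ∨ i = q) ∧
  (∀ i j k l, i < j → j < k → k < l → π i = π k → π j = π l → π i = π j) ∧
  (∀ i j k, i < j → j < k → π i < π j → π k < π j → π i = π k)

set_option synthInstance.maxSize 1000 in
instance (n : ℕ) : DecidablePred (IsNoncrossingValley n) := fun _ => by
  unfold IsNoncrossingValley; infer_instance

theorem card_fiber_eq_two_iff {m n : ℕ} (π : Fin m → Fin n) (v : Fin n) :
    Nat.card {i // π i = v} = 2 ↔ ∃ p q, p < q ∧ ∀ i, π i = v ↔ i = p ∨ i = q := by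
  rw [← Set.coe_ofPred, Nat.card_coe_set_eq, Set.ncard_eq_two]
  simp only [Set.ext_iff, Set.mem_ofPred_eq, Set.mem_insert_iff, Set.mem_singleton_iff]
  constructor
  · rintro ⟨x, y, hxy, h⟩
    rcases lt_or_gt_of_ne hxy with hlt | hlt
    · exact ⟨x, y, hlt, h⟩
    · exact ⟨y, x, hlt, fun i => (h i).trans or_comm⟩
  · rintro ⟨p, q, hpq, h⟩
    exact ⟨p, q, hpq.ne, h⟩

theorem avoids_132_iff (n : ℕ) (π : Fin (2 * n) → Fin n) :
    Avoids3 n ![1, 3, 2] π ↔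
      ∀ i j k, i < j → j < k → π i < π j → π k < π j → ¬ π i < π k := by
  constructor
  · intro h i j k hij hjk h1 h2 h3
    refine h ⟨![i, j, k], ?_, ?_⟩
    · intro a b hab
      fin_cases a <;> fin_cases b <;> simp_all <;> order
    · intro a b
      fin_cases a <;> fin_cases b <;> simp <;> order
  · rintro h ⟨f, hf, hp⟩
    refine h (f 0) (f 1) (f 2) (hf (by decide)) (hf (by decide)) ?_ ?_ ?_
    · exact (hp 0 1).2 (by simp)
    · exact (hp 2 1).2 (by simp)
    · exact (hp 0 2).2 (by simp)

theorem avoids_231_iff (n : ℕ) (π : Fin (2 * n) → Fin n) :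
    Avoids3 n ![2, 3, 1] π ↔
      ∀ i j k, i < j → j < k → π i < π j → π k < π j → ¬ π k < π i := by
  constructor
  · intro h i j k hij hjk h1 h2 h3
    refine h ⟨![i, j, k], ?_, ?_⟩
    · intro a b hab
      fin_cases a <;> fin_cases b <;> simp_all <;> order
    · intro a b
      fin_cases a <;> fin_cases b <;> simp <;> order
  · rintro h ⟨f, hf, hp⟩
    refine h (f 0) (f 1) (f 2) (hf (by decide)) (hf (by decide)) ?_ ?_ ?_
    · exact (hp 0 1).2 (by simp)
    · exact (hp 2 1).2 (by simp)
    · exact (hp 2 0).2 (by simp)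

theorem isQuasiStirling_avoids_iff (n : ℕ) (π : Fin (2 * n) → Fin n) :
    (IsQuasiStirling n π ∧ Avoids3 n ![1, 3, 2] π ∧ Avoids3 n ![2, 3, 1] π) ↔
      IsNoncrossingValley n π := by
  rw [avoids_132_iff, avoids_231_iff]
  unfold IsQuasiStirling IsMultisetPerm IsNoncrossingValley
  simp only [card_fiber_eq_two_iff]
  constructor
  · rintro ⟨⟨h, h1, h2⟩, h3, h4⟩
    refine ⟨h, ?_, ?_⟩
    · intro i j k l hij hjk hkl e1 e2
      rcases lt_trichotomy (π i) (π j) with hlt | heq | hlt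
      · exact absurd ⟨i, j, k, l, hij, hjk, hkl, e1, e2, hlt⟩ h1
      · exact heq
      · exact absurd ⟨i, j, k, l, hij, hjk, hkl, e1, e2, hlt⟩ h2
    · intro i j k hij hjk e1 e2
      exact le_antisymm (not_lt.1 (h4 i j k hij hjk e1 e2)) (not_lt.1 (h3 i j k hij hjk e1 e2))
  · rintro ⟨h, h1, h2⟩
    refine ⟨⟨h, ?_, ?_⟩, ?_, ?_⟩
    · rintro ⟨i, j, k, l, hij, hjk, hkl, e1, e2, hlt⟩
      exact hlt.ne (h1 i j k l hij hjk hkl e1 e2)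
    · rintro ⟨i, j, k, l, hij, hjk, hkl, e1, e2, hlt⟩
      exact hlt.ne' (h1 i j k l hij hjk hkl e1 e2)
    · intro i j k hij hjk e1 e2 e3
      exact e3.ne (h2 i j k hij hjk e1 e2)
    · intro i j k hij hjk e1 e2 e3
      exact e3.ne' (h2 i j k hij hjk e1 e2)

/-- Surround `π` by two copies of a new largest value, `k` of them on the left. -/
def insertMax {n : ℕ} (k : Fin 3) (π : Fin (2 * n) → Fin n) (j : Fin (2 * (n + 1))) :
    Fin (n + 1) :=
  if h : k.val ≤ j.val ∧ j.val < k.val + 2 * n then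
    (π ⟨j.val - k.val, by omega⟩).castSucc
  else Fin.last n

/-- The position in `insertMax k π` of the entry at position `i` of `π`. -/
def blockPos {n : ℕ} (k : Fin 3) (i : Fin (2 * n)) : Fin (2 * (n + 1)) :=
  ⟨i.val + k.val, by omega⟩

theorem blockPos_lt {n : ℕ} {k : Fin 3} {i j : Fin (2 * n)} :
    blockPos k i < blockPos k j ↔ i < j := by
  simp [blockPos]

theorem blockPos_inj {n : ℕ} {k : Fin 3} {i j : Fin (2 * n)} :
    blockPos k i = blockPos k j ↔ i = j := by
  simp [blockPos, Fin.ext_iff]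

theorem exists_blockPos {n : ℕ} {k : Fin 3} {j : Fin (2 * (n + 1))}
    (h : k.val ≤ j.val ∧ j.val < k.val + 2 * n) : ∃ i, j = blockPos k i :=
  ⟨⟨j.val - k.val, by omega⟩, by simp [blockPos, Fin.ext_iff]; omega⟩

theorem insertMax_blockPos {n : ℕ} (k : Fin 3) (π : Fin (2 * n) → Fin n) (i : Fin (2 * n)) :
    insertMax k π (blockPos k i) = (π i).castSucc := by
  have h : k.val ≤ (blockPos k i).val ∧ (blockPos k i).val < k.val + 2 * n := by
    simp [blockPos]; omega
  rw [insertMax, dif_pos h]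
  simp [blockPos]

theorem insertMax_eq_last_iff {n : ℕ} (k : Fin 3) (π : Fin (2 * n) → Fin n)
    (j : Fin (2 * (n + 1))) :
    insertMax k π j = Fin.last n ↔ ¬ (k.val ≤ j.val ∧ j.val < k.val + 2 * n) := by
  unfold insertMax
  split_ifs with h
  · simp [h]
  · simpa using h

theorem exists_blockPos_of_ne_last {n : ℕ} {k : Fin 3} {π : Fin (2 * n) → Fin n}
    {j : Fin (2 * (n + 1))} (h : insertMax k π j ≠ Fin.last n) : ∃ i, j = blockPos k i :=
  exists_blockPos (by simpa only [ne_eq, insertMax_eq_last_iff, not_not] using h)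

theorem blockPos_mem {n : ℕ} (k : Fin 3) (i : Fin (2 * n)) :
    k.val ≤ (blockPos k i).val ∧ (blockPos k i).val < k.val + 2 * n := by
  simp [blockPos]; omega

theorem exists_blockPos_between {n : ℕ} {k : Fin 3} {a c : Fin (2 * n)}
    {j : Fin (2 * (n + 1))} (h1 : blockPos k a < j) (h2 : j < blockPos k c) :
    ∃ i, j = blockPos k i := by
  have ha := blockPos_mem k a
  have hc := blockPos_mem k c
  rw [Fin.lt_def] at h1 h2
  exact exists_blockPos (by omega)

theorem exists_two_positions_last {n : ℕ} (k : Fin 3) (π : Fin (2 * n) → Fin n) :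
    ∃ p q, p < q ∧ ∀ i, insertMax k π i = Fin.last n ↔ i = p ∨ i = q := by
  simp only [insertMax_eq_last_iff]
  simp only [Fin.lt_def, Fin.ext_iff]
  obtain hk | hk | hk : k.val = 0 ∨ k.val = 1 ∨ k.val = 2 := by omega
  · refine ⟨⟨2 * n, by omega⟩, ⟨2 * n + 1, by omega⟩, by dsimp only; omega, fun i => ?_⟩
    dsimp only; omega
  · refine ⟨⟨0, by omega⟩, ⟨2 * n + 1, by omega⟩, by dsimp only; omega, fun i => ?_⟩
    dsimp only; omega
  · refine ⟨⟨0, by omega⟩, ⟨1, by omega⟩, by dsimp only; omega, fun i => ?_⟩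
    dsimp only; omega

theorem isNoncrossingValley_insertMax_iff {n : ℕ} (k : Fin 3) (π : Fin (2 * n) → Fin n) :
    IsNoncrossingValley (n + 1) (insertMax k π) ↔ IsNoncrossingValley n π := by
  constructor
  · rintro ⟨h1, h2, h3⟩
    refine ⟨fun v => ?_, fun i j l m hij hjl hlm e1 e2 => ?_, fun i j l hij hjl e1 e2 => ?_⟩
    · obtain ⟨p, q, hpq, h⟩ := h1 v.castSucc
      obtain ⟨p, rfl⟩ := exists_blockPos_of_ne_last
        (((h p).2 (.inl rfl)).trans_ne v.castSucc_ne_last)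
      obtain ⟨q, rfl⟩ := exists_blockPos_of_ne_last
        (((h q).2 (.inr rfl)).trans_ne v.castSucc_ne_last)
      refine ⟨p, q, blockPos_lt.1 hpq, fun i => ?_⟩
      simpa [insertMax_blockPos, blockPos_inj] using h (blockPos k i)
    · simpa [insertMax_blockPos, blockPos_lt, hij, hjl, hlm, e1, e2] using
        h2 (blockPos k i) (blockPos k j) (blockPos k l) (blockPos k m)
    · simpa [insertMax_blockPos, blockPos_lt, hij, hjl, e1, e2] using
        h3 (blockPos k i) (blockPos k j) (blockPos k l)
  · rintro ⟨h1, h2, h3⟩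
    refine ⟨fun v => ?_, fun i j l m hij hjl hlm e1 e2 => ?_, fun i j l hij hjl e1 e2 => ?_⟩
    · induction v using Fin.lastCases with
      | last => exact exists_two_positions_last k π
      | cast v =>
        obtain ⟨p, q, hpq, h⟩ := h1 v
        refine ⟨blockPos k p, blockPos k q, blockPos_lt.2 hpq, fun i => ?_⟩
        by_cases hi : insertMax k π i = Fin.last n
        · have key : ∀ r, i ≠ blockPos k r := fun r hr => by
            rw [hr, insertMax_blockPos] at hi
            exact (π r).castSucc_ne_last hi
          simp [hi, key, (v.castSucc_ne_last).symm]
        · obtain ⟨i, rfl⟩ := exists_blockPos_of_ne_last hi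
          simpa [insertMax_blockPos, blockPos_inj] using h i
    · by_cases hi : insertMax k π i = Fin.last n
      · by_cases hj : insertMax k π j = Fin.last n
        · rw [hi, hj]
        · obtain ⟨j, rfl⟩ := exists_blockPos_of_ne_last hj
          obtain ⟨m, rfl⟩ := exists_blockPos_of_ne_last (e2 ▸ hj)
          obtain ⟨l, rfl⟩ := exists_blockPos_between hjl hlm
          rw [hi, insertMax_blockPos] at e1
          exact absurd e1.symm (π l).castSucc_ne_last
      · obtain ⟨l, rfl⟩ := exists_blockPos_of_ne_last (e1 ▸ hi)
        obtain ⟨i, rfl⟩ := exists_blockPos_of_ne_last hi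
        obtain ⟨j, rfl⟩ := exists_blockPos_between hij hjl
        rw [insertMax_blockPos k π j] at e2
        obtain ⟨m, rfl⟩ := exists_blockPos_of_ne_last
          (e2.symm.trans_ne (π j).castSucc_ne_last)
        simp only [insertMax_blockPos, blockPos_lt, Fin.castSucc_inj] at *
        exact h2 i j l m hij hjl hlm e1 e2
    · obtain ⟨i, rfl⟩ := exists_blockPos_of_ne_last (e1.trans_le (Fin.le_last _)).ne
      obtain ⟨l, rfl⟩ := exists_blockPos_of_ne_last (e2.trans_le (Fin.le_last _)).ne
      obtain ⟨j, rfl⟩ := exists_blockPos_between hij hjl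
      simp only [insertMax_blockPos, blockPos_lt, Fin.castSucc_lt_castSucc_iff,
        Fin.castSucc_inj] at *
      exact h3 i j l hij hjl e1 e2

theorem insertMax_injective {n : ℕ} (hn : 2 ≤ n) {k k' : Fin 3} {π π' : Fin (2 * n) → Fin n}
    (h : insertMax k π = insertMax k' π') : k = k' ∧ π = π' := by
  have key (j) := (insertMax_eq_last_iff k π j).symm.trans
    (h ▸ insertMax_eq_last_iff k' π' j)
  have hk : k = k' := by
    have h0 := key ⟨0, by omega⟩
    have h1 := key ⟨2 * n + 1, by omega⟩
    simp only at h0 h1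
    omega
  subst hk
  refine ⟨rfl, funext fun i => ?_⟩
  have := congrFun h (blockPos k i)
  simpa [insertMax_blockPos] using this

/-- An occurrence of the largest value cannot separate other values. -/
theorem IsNoncrossingValley.not_separated {n : ℕ} (hn : 2 ≤ n)
    {π : Fin (2 * (n + 1)) → Fin (n + 1)} (h : IsNoncrossingValley (n + 1) π)
    {a r b : Fin (2 * (n + 1))} (har : a < r) (hrb : r < b) (hr : π r = Fin.last n)
    (ha : π a ≠ Fin.last n) (hb : π b ≠ Fin.last n) : False := by
  obtain ⟨h1, -, h3⟩ := h
  have sep {x y} (hx : x < r) (hy : r < y) (hx' : π x ≠ Fin.last n) (hy' : π y ≠ Fin.last n) :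
      π x = π y :=
    h3 x r y hx hy (hr ▸ Fin.lt_last_iff_ne_last.2 hx') (hr ▸ Fin.lt_last_iff_ne_last.2 hy')
  have all_eq (x) (hx : π x ≠ Fin.last n) : π x = π a := by
    rcases lt_trichotomy x r with hlt | rfl | hlt
    · exact (sep hlt hrb hx hb).trans (sep har hrb ha hb).symm
    · exact absurd hr hx
    · exact (sep har hlt ha hx).symm
  have val_eq (v : Fin (n + 1)) (hv : v ≠ Fin.last n) : v = π a := by
    obtain ⟨p, q, -, hp⟩ := h1 v
    have e := (hp p).2 (.inl rfl)
    exact e ▸ all_eq p (e ▸ hv)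
  have e0 := val_eq ⟨0, by omega⟩ (by simp [Fin.ext_iff]; omega)
  have e1 := val_eq ⟨1, by omega⟩ (by simp [Fin.ext_iff]; omega)
  simpa [Fin.ext_iff] using e0.trans e1.symm

theorem IsNoncrossingValley.exists_last_iff {n : ℕ} (hn : 2 ≤ n)
    {π : Fin (2 * (n + 1)) → Fin (n + 1)} (h : IsNoncrossingValley (n + 1) π) :
    ∃ k : Fin 3, ∀ j, π j = Fin.last n ↔ ¬ (k.val ≤ j.val ∧ j.val < k.val + 2 * n) := by
  obtain ⟨p, q, hpq, hl⟩ := h.1 (Fin.last n)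
  have sep (a r b : Fin (2 * (n + 1))) (har : a.val < r.val) (hrb : r.val < b.val)
      (hr : r.val = p.val ∨ r.val = q.val) (ha : a.val ≠ p.val ∧ a.val ≠ q.val)
      (hb : b.val ≠ p.val ∧ b.val ≠ q.val) : False := by
    refine h.not_separated hn har hrb ?_ ?_ ?_
    · rw [hl]; simpa only [Fin.ext_iff] using hr
    · rw [ne_eq, hl]; simpa only [Fin.ext_iff, not_or] using ha
    · rw [ne_eq, hl]; simpa only [Fin.ext_iff, not_or] using hb
  simp only [hl, Fin.ext_iff]
  rw [Fin.lt_def] at hpq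
  have hp : p.val = 0 ∨ p.val = 2 * n := by
    by_contra! hcon
    have h0 : 0 < p.val := by omega
    by_cases hq : q.val = 2 * n + 1
    · exact sep ⟨0, by omega⟩ p ⟨2 * n, by omega⟩ (by dsimp only; omega) (by dsimp only; omega) (.inl rfl)
        (by dsimp only; omega) (by dsimp only; omega)
    · exact sep ⟨0, by omega⟩ p ⟨2 * n + 1, by omega⟩ (by dsimp only; omega) (by dsimp only; omega) (.inl rfl)
        (by dsimp only; omega) (by dsimp only; omega)
  have hq : q.val = 1 ∨ q.val = 2 * n + 1 := by
    by_contra! hcon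
    by_cases hp0 : p.val = 0
    · exact sep ⟨1, by omega⟩ q ⟨2 * n + 1, by omega⟩ (by dsimp only; omega) (by dsimp only; omega) (.inr rfl)
        (by dsimp only; omega) (by dsimp only; omega)
    · exact sep ⟨0, by omega⟩ q ⟨2 * n + 1, by omega⟩ (by dsimp only; omega) (by dsimp only; omega) (.inr rfl)
        (by dsimp only; omega) (by dsimp only; omega)
  rcases hp with hp | hp
  · rcases hq with hq | hq
    · exact ⟨2, fun j => by simp; omega⟩
    · exact ⟨1, fun j => by simp; omega⟩
  · exact ⟨0, fun j => by simp; omega⟩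

theorem IsNoncrossingValley.exists_eq_insertMax {n : ℕ} (hn : 2 ≤ n)
    {π : Fin (2 * (n + 1)) → Fin (n + 1)} (h : IsNoncrossingValley (n + 1) π) :
    ∃ k ρ, insertMax k ρ = π := by
  obtain ⟨k, hk⟩ := h.exists_last_iff hn
  have hne (i : Fin (2 * n)) : π (blockPos k i) ≠ Fin.last n := by
    rw [ne_eq, hk, not_not]
    exact blockPos_mem k i
  refine ⟨k, fun i => (π (blockPos k i)).castPred (hne i), funext fun j => ?_⟩
  by_cases hj : k.val ≤ j.val ∧ j.val < k.val + 2 * n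
  · obtain ⟨i, rfl⟩ := exists_blockPos hj
    rw [insertMax_blockPos, Fin.castSucc_castPred]
  · rw [(insertMax_eq_last_iff _ _ _).2 hj, (hk j).2 hj]

theorem card_isNoncrossingValley_succ {n : ℕ} (hn : 2 ≤ n) :
    Nat.card {π // IsNoncrossingValley (n + 1) π} =
      3 * Nat.card {π // IsNoncrossingValley n π} := by
  let f : Fin 3 × {π // IsNoncrossingValley n π} → {π // IsNoncrossingValley (n + 1) π} :=
    fun x => ⟨insertMax x.1 x.2.1, (isNoncrossingValley_insertMax_iff _ _).2 x.2.2⟩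
  have hf : Function.Bijective f := by
    constructor
    · rintro ⟨k, π, hπ⟩ ⟨k', π', hπ'⟩ h
      obtain ⟨rfl, rfl⟩ := insertMax_injective hn (congrArg Subtype.val h)
      rfl
    · rintro ⟨π, hπ⟩
      obtain ⟨k, ρ, rfl⟩ := hπ.exists_eq_insertMax hn
      exact ⟨⟨k, ρ, (isNoncrossingValley_insertMax_iff _ _).1 hπ⟩, rfl⟩
  rw [← Nat.card_eq_of_bijective f hf, Nat.card_prod, Nat.card_fin]

theorem card_isNoncrossingValley_two : Nat.card {π // IsNoncrossingValley 2 π} = 4 := by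
  rw [Nat.card_eq_fintype_card]
  decide

theorem quasiStirling_avoiding_132_231 (n : ℕ) (hn : 2 ≤ n) :
    Nat.card {π : Fin (2 * n) → Fin n //
      IsQuasiStirling n π ∧ Avoids3 n ![1, 3, 2] π ∧ Avoids3 n ![2, 3, 1] π} =
      4 * 3 ^ (n - 2) := by
  simp only [isQuasiStirling_avoids_iff]
  induction n, hn using Nat.le_induction with
  | base => exact card_isNoncrossingValley_two
  | succ n hn ih =>
    rw [card_isNoncrossingValley_succ hn, ih, Nat.sub_add_comm hn, pow_succ]
    ring
end

section
/- For every n ≥ 2, the number of quasi-Stirling permutations of the multiset [n,n] that avoid both patterns 132 and 321 equals 2n² − 3n + 2. -/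
/-- The letter at position `p` of the word obtained from `0,0,1,1,2,2,…` by moving the block of
`L` letters starting at position `a` to the front. -/
def swapWord (a L p : ℕ) : ℕ :=
  if p < L then (p + a) / 2 else if p < a + L then (p - L) / 2 else p / 2

/-- The letter at position `p` of the word obtained from `1,1,2,2,…` by inserting one `0` right
after the letters `1,…,k` and another one right after the letters `1,…,l`. -/
def zeroWord (k l p : ℕ) : ℕ :=
  if p < 2 * k then p / 2 + 1 else if p = 2 * k then 0
  else if p ≤ 2 * l then (p + 1) / 2 else if p = 2 * l + 1 then 0 else p / 2

/-- Quasi-Stirling permutations avoiding 132 and 321. -/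
def IsGood (n : ℕ) (π : Fin (2 * n) → Fin n) : Prop :=
  IsQuasiStirling n π ∧ Avoids3 n ![1, 3, 2] π ∧ Avoids3 n ![3, 2, 1] π

theorem avoids3_132_iff {n : ℕ} {π : Fin (2 * n) → Fin n} :
    Avoids3 n ![1, 3, 2] π ↔ ∀ i j k, i < j → j < k → ¬ (π i < π k ∧ π k < π j) := by
  constructor
  · intro h i j k hij hjk hlt
    refine h ⟨![i, j, k], ?_, ?_⟩
    · simp [Fin.strictMono_iff_lt_succ, Fin.forall_fin_succ, hij, hjk]
    · simp [Fin.forall_fin_succ]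
      grind
  · rintro h ⟨f, hf, hv⟩
    refine h (f 0) (f 1) (f 2) (hf (by decide)) (hf (by decide)) ⟨?_, ?_⟩ <;> simp [hv]

theorem avoids3_321_iff {n : ℕ} {π : Fin (2 * n) → Fin n} :
    Avoids3 n ![3, 2, 1] π ↔ ∀ i j k, i < j → j < k → ¬ (π k < π j ∧ π j < π i) := by
  constructor
  · intro h i j k hij hjk hlt
    refine h ⟨![i, j, k], ?_, ?_⟩
    · simp [Fin.strictMono_iff_lt_succ, Fin.forall_fin_succ, hij, hjk]
    · simp [Fin.forall_fin_succ]
      grind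
  · rintro h ⟨f, hf, hv⟩
    refine h (f 0) (f 1) (f 2) (hf (by decide)) (hf (by decide)) ⟨?_, ?_⟩ <;> simp [hv]

theorem isGood_of_nat {n : ℕ} {f : ℕ → ℕ} (hf : ∀ p : Fin (2 * n), f p < n)
    (hcount : ∀ v < n, ∃ p q, p < 2 * n ∧ q < 2 * n ∧ p ≠ q ∧
      ∀ r < 2 * n, f r = v ↔ r = p ∨ r = q)
    (hadj : ∃ u, ∀ i k, i < k → k < 2 * n → f i = f k → k = i + 1 ∨ f i = u)
    (h132 : ∀ i j k, i < j → j < k → k < 2 * n → ¬ (f i < f k ∧ f k < f j))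
    (h321 : ∀ i j k, i < j → j < k → k < 2 * n → ¬ (f k < f j ∧ f j < f i)) :
    IsGood n (fun p => ⟨f p, hf p⟩) := by
  have hcross : ∀ i j k l : ℕ, i < j → j < k → k < l → l < 2 * n → f i = f k → f j = f l →
      f i = f j := by
    obtain ⟨u, hu⟩ := hadj
    intro i j k l hij hjk hkl hl hik hjl
    have := hu i k (by omega) (by omega) hik
    have := hu j l (by omega) (by omega) hjl
    omega
  refine ⟨⟨fun v => ?_, ?_, ?_⟩, ?_, ?_⟩
  · obtain ⟨p, q, hp, hq, hpq, h⟩ := hcount v v.2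
    rw [Nat.card_eq_fintype_card, Fintype.card_subtype, Finset.card_eq_two]
    refine ⟨⟨p, hp⟩, ⟨q, hq⟩, by simpa using hpq, ?_⟩
    ext r
    simp [Fin.ext_iff, h r r.2]
  · rintro ⟨i, j, k, l, hij, hjk, hkl, hik, hjl, hlt⟩
    have := hcross i j k l hij hjk hkl l.2 (Fin.mk.inj hik) (Fin.mk.inj hjl)
    exact absurd this (Fin.mk_lt_mk.1 hlt).ne
  · rintro ⟨i, j, k, l, hij, hjk, hkl, hik, hjl, hlt⟩
    have := hcross i j k l hij hjk hkl l.2 (Fin.mk.inj hik) (Fin.mk.inj hjl)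
    exact absurd this (Fin.mk_lt_mk.1 hlt).ne'
  · exact avoids3_132_iff.2 fun i j k hij hjk => h132 i j k hij hjk k.2
  · exact avoids3_321_iff.2 fun i j k hij hjk => h321 i j k hij hjk k.2

/-- The pairs `(a, L)` whose `swapWord` is a good permutation of `[n,n]`, normalized so that
distinct pairs give distinct words. -/
structure IsSwapParam (n a L : ℕ) : Prop where
  two_le : 2 ≤ a
  add_le : a + L ≤ 2 * n
  parity : a % 2 = 0 ∨ L % 2 = 1
  odd_of_one : L = 1 → a % 2 = 1
  eq_two_of_zero : L = 0 → a = 2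

theorem swapWord_lt {n a L p : ℕ} (h : a + L ≤ 2 * n) (hp : p < 2 * n) :
    swapWord a L p < n := by
  unfold swapWord
  split_ifs <;> omega

theorem zeroWord_lt {n k l p : ℕ} (hkl : k < l) (hl : l < n) (hp : p < 2 * n) :
    zeroWord k l p < n := by
  unfold zeroWord
  split_ifs <;> omega

theorem isGood_swapWord {n a L : ℕ} (h : IsSwapParam n a L)
    (hf : ∀ p : Fin (2 * n), swapWord a L p < n) :
    IsGood n (fun p => ⟨swapWord a L p, hf p⟩) := by
  obtain ⟨h2, hle, hpar, -, -⟩ := h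
  apply isGood_of_nat hf
  · intro v hv
    let pos (t : ℕ) := if t < a then t + L else if t < a + L then t - a else t
    refine ⟨pos (2 * v), pos (2 * v + 1), ?_, ?_, ?_, fun r hr => ?_⟩
    all_goals
      simp only [pos, swapWord]
      split_ifs <;> omega
  · refine ⟨if a % 2 = 1 then a / 2 else (a + L) / 2, fun i k hik hk => ?_⟩
    unfold swapWord
    split_ifs <;> omega
  · intro i j k hij hjk hk
    unfold swapWord
    split_ifs <;> omega
  · intro i j k hij hjk hk
    unfold swapWord
    split_ifs <;> omega

theorem zeroWord_le {k l p q : ℕ} (hkl : k < l) (hpq : p ≤ q) (hq : zeroWord k l q ≠ 0) :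
    zeroWord k l p ≤ zeroWord k l q := by
  unfold zeroWord at *
  split_ifs at * <;> omega

theorem isGood_zeroWord {n k l : ℕ} (hkl : k < l) (hl : l < n)
    (hf : ∀ p : Fin (2 * n), zeroWord k l p < n) :
    IsGood n (fun p => ⟨zeroWord k l p, hf p⟩) := by
  apply isGood_of_nat hf
  · intro v hv
    let pos (t : ℕ) := if t = 0 then 2 * k else if t = 1 then 2 * l + 1 else
      if t < 2 * k + 2 then t - 2 else if t < 2 * l + 2 then t - 1 else t
    refine ⟨pos (2 * v), pos (2 * v + 1), ?_, ?_, ?_, fun r hr => ?_⟩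
    all_goals
      simp only [pos, zeroWord]
      split_ifs <;> first | omega | grind
  · refine ⟨0, fun i k hik hk => ?_⟩
    unfold zeroWord
    split_ifs <;> first | omega | grind
  · intro i j k hij hjk hk h
    exact h.2.not_ge (zeroWord_le hkl hjk.le (by omega))
  · intro i j k' hij hjk hk h
    exact h.2.not_ge (zeroWord_le hkl hij.le (by omega))

/-- An index type for the good permutations of `[n,n]`. -/
abbrev Code (n : ℕ) : Type := Unit ⊕ (Fin n × Fin (n - 1)) ⊕ (Fin (n - 1) × Fin (n - 1))

/-- The parameters of the word with a given index, for `swapWord` (left) or `zeroWord` (right). -/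
def codeParam {n : ℕ} : Code n → (ℕ × ℕ) ⊕ (ℕ × ℕ)
  | .inl _ => .inl (2, 0)
  | .inr (.inl (x, y)) =>
      if y.val < x.val then .inr (y, x) else .inl (2 * x + 2, 2 * (y - x) + 2)
  | .inr (.inr (x, y)) =>
      if x ≤ y then .inl (2 * x + 3, 2 * (y.val - x) + 1)
      else .inl (2 * y + 2, 2 * (x.val - y) + 1)

theorem codeParam_injective (n : ℕ) : Function.Injective (codeParam (n := n)) := by
  rintro (_ | ⟨x, y⟩ | ⟨x, y⟩) (_ | ⟨x', y'⟩ | ⟨x', y'⟩) h <;>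
    simp only [codeParam] at h <;> (try split_ifs at h) <;>
    simp only [Sum.inl.injEq, Sum.inr.injEq, Prod.mk.injEq, reduceCtorEq, Fin.ext_iff] at h ⊢ <;>
    first | omega | simp at h

theorem exists_codeParam_eq_inr {n k l : ℕ} (hkl : k < l) (hl : l < n) :
    ∃ c : Code n, codeParam c = .inr (k, l) :=
  ⟨.inr (.inl (⟨l, hl⟩, ⟨k, by omega⟩)), if_pos hkl⟩

theorem exists_codeParam_eq_inl {n a L : ℕ} (h : IsSwapParam n a L) :
    ∃ c : Code n, codeParam c = .inl (a, L) := by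
  obtain ⟨h2, hle, hpar, hone, hzero⟩ := h
  rcases Nat.eq_zero_or_pos L with rfl | hL
  · exact ⟨.inl (), by rw [hzero rfl]; rfl⟩
  · rcases Nat.mod_two_eq_zero_or_one L with hL2 | hL2
    · refine ⟨.inr (.inl (⟨a / 2 - 1, by omega⟩, ⟨a / 2 + L / 2 - 2, by omega⟩)), ?_⟩
      refine (if_neg (by simp only; omega)).trans ?_
      congr 2 <;> simp only <;> omega
    · rcases Nat.mod_two_eq_zero_or_one a with ha | ha
      · refine ⟨.inr (.inr (⟨a / 2 + L / 2 - 1, by omega⟩, ⟨a / 2 - 1, by omega⟩)), ?_⟩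
        refine (if_neg (by simp only [Fin.mk_le_mk]; omega)).trans ?_
        congr 2 <;> simp only <;> omega
      · refine ⟨.inr (.inr (⟨a / 2 - 1, by omega⟩, ⟨a / 2 + L / 2 - 1, by omega⟩)), ?_⟩
        refine (if_pos (by simp only [Fin.mk_le_mk]; omega)).trans ?_
        congr 2 <;> simp only <;> omega

/-- The word with a given index. -/
def codeWord {n : ℕ} (c : Code n) : ℕ → ℕ :=
  Sum.elim (fun q => swapWord q.1 q.2) (fun q => zeroWord q.1 q.2) (codeParam c)

theorem codeParam_cases {n : ℕ} (hn : 0 < n) (c : Code n) :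
    (∃ a L, IsSwapParam n a L ∧ codeParam c = .inl (a, L)) ∨
      ∃ k l, k < l ∧ l < n ∧ codeParam c = .inr (k, l) := by
  rcases c with _ | ⟨x, y⟩ | ⟨x, y⟩
  · exact .inl ⟨2, 0, by constructor <;> omega, rfl⟩
  · by_cases h : y.val < x.val
    · exact .inr ⟨y, x, h, x.2, if_pos h⟩
    · exact .inl ⟨_, _, by constructor <;> omega, if_neg h⟩
  · by_cases h : x ≤ y
    · exact .inl ⟨_, _, by constructor <;> omega, if_pos h⟩
    · exact .inl ⟨_, _, by constructor <;> omega, if_neg h⟩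

theorem swapWord_eq_zero_iff {a L p : ℕ} (ha : 2 ≤ a) :
    swapWord a L p = 0 ↔ p = L ∨ p = L + 1 := by
  unfold swapWord
  split_ifs <;> omega

theorem zeroWord_eq_zero_iff {k l p : ℕ} (hkl : k < l) :
    zeroWord k l p = 0 ↔ p = 2 * k ∨ p = 2 * l + 1 := by
  unfold zeroWord
  split_ifs <;> first | omega | grind

theorem swapWord_inj {n a L a' L' : ℕ} (h : IsSwapParam n a L) (h' : IsSwapParam n a' L')
    (heq : ∀ p < 2 * n, swapWord a L p = swapWord a' L' p) :
    a = a' ∧ L = L' := by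
  obtain ⟨h2, hle, hpar, hone, hzero⟩ := h
  obtain ⟨h2', hle', hpar', hone', hzero'⟩ := h'
  have hLL : L = L' := by
    have e1 := (swapWord_eq_zero_iff h2').1
      ((heq L (by omega)).symm.trans ((swapWord_eq_zero_iff h2).2 (.inl rfl)))
    have e2 := (swapWord_eq_zero_iff h2').1
      ((heq (L + 1) (by omega)).symm.trans ((swapWord_eq_zero_iff h2).2 (.inr rfl)))
    omega
  subst hLL
  refine ⟨?_, rfl⟩
  by_contra! hne
  have e0 := heq 0 (by omega)
  have e1 := heq 1 (by omega)
  unfold swapWord at e0 e1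
  split_ifs at e0 e1 <;> omega

theorem zeroWord_inj {n k l k' l' : ℕ} (h : k < l) (hl : l < n) (h' : k' < l')
    (heq : ∀ p < 2 * n, zeroWord k l p = zeroWord k' l' p) : k = k' ∧ l = l' := by
  have e1 := (zeroWord_eq_zero_iff h').1
    ((heq (2 * k) (by omega)).symm.trans ((zeroWord_eq_zero_iff h).2 (.inl rfl)))
  have e2 := (zeroWord_eq_zero_iff h').1
    ((heq (2 * l + 1) (by omega)).symm.trans ((zeroWord_eq_zero_iff h).2 (.inr rfl)))
  omega

theorem swapWord_ne_zeroWord {n a L k l : ℕ} (h : IsSwapParam n a L) (hkl : k < l)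
    (heq : ∀ p < 2 * n, swapWord a L p = zeroWord k l p) : False := by
  obtain ⟨h2, hle, -, -, -⟩ := h
  have e1 := (zeroWord_eq_zero_iff hkl).1
    ((heq L (by omega)).symm.trans ((swapWord_eq_zero_iff h2).2 (.inl rfl)))
  have e2 := (zeroWord_eq_zero_iff hkl).1
    ((heq (L + 1) (by omega)).symm.trans ((swapWord_eq_zero_iff h2).2 (.inr rfl)))
  omega

/-- The letters of a word over `Fin n`, as a list of natural numbers. -/
def letters {n : ℕ} (π : Fin (2 * n) → Fin n) : List ℕ :=
  List.ofFn fun i => (π i : ℕ)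

/-- The word `0,0,1,1,…,n-1,n-1`. -/
def doubled (n : ℕ) : List ℕ :=
  (List.range (2 * n)).map (· / 2)

theorem doubled_succ (n : ℕ) : doubled (n + 1) = doubled n ++ [n, n] := by
  have h : 2 * (n + 1) = 2 * n + 1 + 1 := by ring
  simp only [doubled, h, List.range_succ, List.map_append, List.map_cons, List.map_nil,
    List.append_assoc, List.cons_append, List.nil_append]
  congr 3 <;> omega

theorem count_doubled (n v : ℕ) : (doubled n).count v = if v < n then 2 else 0 := by
  induction n with
  | zero => simp [doubled]
  | succ n ih =>
    rw [doubled_succ, List.count_append, ih]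
    simp only [List.count_cons, List.count_nil, beq_iff_eq]
    split_ifs <;> omega

theorem pairwise_doubled (n : ℕ) : (doubled n).Pairwise (· ≤ ·) := by
  rw [doubled, List.pairwise_map]
  exact List.pairwise_lt_range.imp fun h => Nat.div_le_div_right h.le

theorem getElem?_of_doubled_eq {n : ℕ} {X Y Z : List ℕ} (h : X ++ (Y ++ Z) = doubled n) {t : ℕ}
    (ht : t < Y.length) : Y[t]? = some ((X.length + t) / 2) := by
  have h1 : (X ++ (Y ++ Z))[X.length + t]? = (doubled n)[X.length + t]? := by rw [h]
  have h2 : X.length + t < 2 * n := by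
    have := congrArg List.length h
    simp [doubled] at this
    omega
  rw [List.getElem?_append_right (by omega), Nat.add_sub_cancel_left,
    List.getElem?_append_left ht] at h1
  simpa [doubled, h2] using h1

theorem length_doubled (n : ℕ) : (doubled n).length = 2 * n := by
  simp [doubled]

theorem perm_doubled {n : ℕ} {π : Fin (2 * n) → Fin n} (h : IsMultisetPerm n π) :
    (letters π).Perm (doubled n) := by
  rw [List.perm_iff_count]
  intro v
  rw [count_doubled]
  split_ifs with hv
  · rw [← h ⟨v, hv⟩, Nat.card_eq_fintype_card, Fintype.card_subtype, ← Multiset.coe_count, letters,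
      ← Fin.univ_val_map, Multiset.count_map, Finset.card_def, Finset.filter_val]
    congr 2
    funext i
    simp [Fin.ext_iff, eq_comm]
  · refine List.count_eq_zero_of_not_mem fun hmem => ?_
    obtain ⟨i, rfl⟩ := (List.mem_ofFn' _ _).1 hmem
    exact hv (π i).2

theorem exists_strictMono_of_sublist_letters {n m : ℕ} {π : Fin (2 * n) → Fin n} {x : Fin m → ℕ}
    (h : (List.ofFn x).Sublist (letters π)) :
    ∃ f : Fin m → Fin (2 * n), StrictMono f ∧ ∀ i, (π (f i) : ℕ) = x i := by
  obtain ⟨f, hf⟩ := List.sublist_iff_exists_fin_orderEmbedding_get_eq.1 h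
  refine ⟨fun i => (f (i.cast (by simp))).cast (by simp [letters]), fun i j hij => ?_, fun i => ?_⟩
  · exact f.strictMono (a := i.cast _) (b := j.cast _) hij
  · have := hf (i.cast (by simp))
    simp [letters] at this
    exact this.symm

/-- The list version of `IsGood`. -/
structure IsGoodList (n : ℕ) (w : List ℕ) : Prop where
  perm : w.Perm (doubled n)
  not_132 : ∀ {x y z}, [x, y, z].Sublist w → ¬ (x < z ∧ z < y)
  not_321 : ∀ {x y z}, [x, y, z].Sublist w → ¬ (z < y ∧ y < x)
  not_cross : ∀ {x y}, [x, y, x, y].Sublist w → x = y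

theorem IsGood.isGoodList {n : ℕ} {π : Fin (2 * n) → Fin n} (h : IsGood n π) :
    IsGoodList n (letters π) := by
  obtain ⟨⟨hperm, h1212, h2121⟩, h132, h321⟩ := h
  refine ⟨perm_doubled hperm, fun {x y z} hs => ?_, fun {x y z} hs => ?_, fun {x y} hs => ?_⟩
  · obtain ⟨f, hf, hv⟩ := exists_strictMono_of_sublist_letters (x := ![x, y, z]) (by simpa using hs)
    have := avoids3_132_iff.1 h132 (f 0) (f 1) (f 2) (hf (by decide)) (hf (by decide))
    simpa [Fin.lt_def, hv] using this
  · obtain ⟨f, hf, hv⟩ := exists_strictMono_of_sublist_letters (x := ![x, y, z]) (by simpa using hs)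
    have := avoids3_321_iff.1 h321 (f 0) (f 1) (f 2) (hf (by decide)) (hf (by decide))
    simpa [Fin.lt_def, hv] using this
  · obtain ⟨f, hf, hv⟩ :=
      exists_strictMono_of_sublist_letters (x := ![x, y, x, y]) (by simpa using hs)
    have hx : π (f 0) = π (f 2) := by simp [Fin.ext_iff, hv]
    have hy : π (f 1) = π (f 3) := by simp [Fin.ext_iff, hv]
    by_contra hne
    rcases Nat.lt_or_gt_of_ne hne with hlt | hlt
    · exact h1212 ⟨f 0, f 1, f 2, f 3, hf (by decide), hf (by decide), hf (by decide), hx, hy,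
        by simpa [Fin.lt_def, hv] using hlt⟩
    · exact h2121 ⟨f 0, f 1, f 2, f 3, hf (by decide), hf (by decide), hf (by decide), hx, hy,
        by simpa [Fin.lt_def, hv] using hlt⟩

theorem pairwise_append_of_ne_nil {A B C : List ℕ} (hB : B ≠ [])
    (hAB : (A ++ B).Pairwise (· ≤ ·)) (hBC : (B ++ C).Pairwise (· ≤ ·)) :
    (A ++ (B ++ C)).Pairwise (· ≤ ·) := by
  rw [List.pairwise_append] at hAB ⊢
  refine ⟨hAB.1, hBC, fun a ha x hx => ?_⟩
  rcases List.mem_append.1 hx with hx | hx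
  · exact hAB.2.2 a ha x hx
  · obtain ⟨b, hb⟩ := List.exists_mem_of_ne_nil B hB
    exact (hAB.2.2 a ha b hb).trans ((List.pairwise_append.1 hBC).2.2 b hb x hx)

theorem IsGoodList.exists_split {n : ℕ} (hn : 0 < n) {w : List ℕ} (h : IsGoodList n w) :
    ∃ A B C, w = A ++ 0 :: (B ++ 0 :: C) ∧ 0 ∉ A ∧ 0 ∉ B ∧ 0 ∉ C := by
  have hc : w.count 0 = 2 := by rw [h.perm.count_eq, count_doubled, if_pos hn]
  obtain ⟨A, D, rfl⟩ := List.append_of_mem (List.count_pos_iff.1 (by omega : 0 < w.count 0))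
  by_cases hD : 0 ∈ D
  · obtain ⟨B, C, rfl⟩ := List.append_of_mem hD
    refine ⟨A, B, C, rfl, ?_⟩
    simp only [List.count_append, List.count_cons_self] at hc
    simp only [← List.count_eq_zero]
    omega
  · by_cases hA : 0 ∈ A
    · obtain ⟨A, B, rfl⟩ := List.append_of_mem hA
      refine ⟨A, B, D, by simp, ?_⟩
      simp only [List.count_append, List.count_cons_self] at hc
      simp only [← List.count_eq_zero]
      omega
    · simp [List.count_eq_zero.2 hD, List.count_eq_zero.2 hA] at hc

theorem IsGoodList.eq_zeroWord {n : ℕ} {A B C : List ℕ}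
    (h : IsGoodList n (A ++ 0 :: (B ++ 0 :: C))) (hA : 0 ∉ A) (hB : 0 ∉ B) (hC : 0 ∉ C)
    (hne : B ≠ []) :
    ∃ k l, k < l ∧ l < n ∧
      ∀ p < 2 * n, (A ++ 0 :: (B ++ 0 :: C))[p]? = some (zeroWord k l p) := by
  have hBC : (B ++ C).Pairwise (· ≤ ·) := by
    rw [List.pairwise_iff_forall_sublist]
    intro x y hs
    have hy : 0 < y := Nat.pos_of_ne_zero fun h0 => by
      have := hs.subset (by simp : y ∈ [x, y])
      simp_all
    by_contra! hlt
    refine h.not_132 (x := 0) (y := x) (z := y) ?_ ⟨hy, hlt⟩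
    refine List.Sublist.trans ?_ (List.sublist_append_right _ _)
    refine List.Sublist.cons_cons _ (hs.trans ?_)
    simp
  have hAB : (A ++ B).Pairwise (· ≤ ·) := by
    rw [List.pairwise_iff_forall_sublist]
    intro x y hs
    have hy : 0 < y := Nat.pos_of_ne_zero fun h0 => by
      have := hs.subset (by simp : y ∈ [x, y])
      simp_all
    by_contra! hlt
    refine h.not_321 (x := x) (y := y) (z := 0) ?_ ⟨hy, hlt⟩
    have : ([x, y] ++ [0]).Sublist ((A ++ B) ++ 0 :: C) := hs.append (by simp)
    refine List.Sublist.trans this ?_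
    simp
  have heq : [0, 0] ++ (A ++ (B ++ C)) = doubled n := by
    refine List.Perm.eq_of_pairwise' (r := (· ≤ ·)) ?_ (pairwise_doubled n) ?_
    · have := pairwise_append_of_ne_nil hne hAB hBC
      simpa using this
    · refine List.Perm.trans ?_ h.perm
      rw [List.perm_iff_count]
      intro v
      simp only [List.count_append, List.count_cons, List.count_nil]
      omega
  have eA {t : ℕ} (ht : t < A.length) : A[t]? = some ((2 + t) / 2) :=
    getElem?_of_doubled_eq heq ht
  have eB {t : ℕ} (ht : t < B.length) : B[t]? = some ((2 + A.length + t) / 2) := by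
    rw [getElem?_of_doubled_eq (X := [0, 0] ++ A) (by simpa using heq) ht, List.length_append]
    rfl
  have eC {t : ℕ} (ht : t < C.length) : C[t]? = some ((2 + A.length + B.length + t) / 2) := by
    rw [getElem?_of_doubled_eq (X := [0, 0] ++ A ++ B) (Z := []) (by simpa using heq) ht,
      List.length_append, List.length_append]
    rfl
  have hBpos := List.length_pos_iff.2 hne
  have hlen := congrArg List.length heq
  simp only [List.length_append, length_doubled, List.length_cons, List.length_nil] at hlen
  have hAeven : A.length % 2 = 0 := by
    by_contra hodd
    have hmA := List.mem_of_getElem? (eA (t := A.length - 1) (by omega))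
    have hmB := List.mem_of_getElem? (eB (t := 0) (by omega))
    rw [show (2 + A.length + 0) / 2 = (2 + (A.length - 1)) / 2 by omega] at hmB
    refine hA (h.not_cross (y := 0) ?_ ▸ hmA)
    exact (List.singleton_sublist.2 hmA).append (l₁ := [_]) <| List.Sublist.cons_cons _ <|
      (List.singleton_sublist.2 hmB).append (l₁ := [_]) (by simp)
  have hBeven : B.length % 2 = 0 := by
    by_contra hodd
    have hmB := List.mem_of_getElem? (eB (t := B.length - 1) (by omega))
    have hmC := List.mem_of_getElem? (eC (t := 0) (by omega))
    rw [show (2 + A.length + B.length + 0) / 2 = (2 + A.length + (B.length - 1)) / 2 by omega]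
      at hmC
    refine hB (h.not_cross (x := 0) ?_ ▸ hmB)
    refine List.Sublist.trans ?_ (List.sublist_append_right _ _)
    exact List.Sublist.cons_cons _ <| (List.singleton_sublist.2 hmB).append (l₁ := [_]) <|
      List.Sublist.cons_cons _ (List.singleton_sublist.2 hmC)
  refine ⟨A.length / 2, A.length / 2 + B.length / 2, by omega, by omega, fun p hp => ?_⟩
  unfold zeroWord
  rcases lt_or_ge p A.length with h1 | h1
  · rw [List.getElem?_append_left h1, eA h1, Option.some_inj]
    split_ifs <;> omega
  obtain ⟨q, rfl⟩ := Nat.exists_eq_add_of_le h1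
  rw [List.getElem?_append_right h1, Nat.add_sub_cancel_left]
  rcases q with _ | q
  · rw [List.getElem?_cons_zero, Option.some_inj]
    split_ifs <;> omega
  rw [List.getElem?_cons_succ]
  rcases lt_or_ge q B.length with h2 | h2
  · rw [List.getElem?_append_left h2, eB h2, Option.some_inj]
    split_ifs <;> omega
  obtain ⟨r, rfl⟩ := Nat.exists_eq_add_of_le h2
  rw [List.getElem?_append_right h2, Nat.add_sub_cancel_left]
  rcases r with _ | r
  · rw [List.getElem?_cons_zero, Option.some_inj]
    split_ifs <;> omega
  rw [List.getElem?_cons_succ, eC (by omega), Option.some_inj]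
  split_ifs <;> omega

theorem exists_append_of_pairwise_le (m : ℕ) {C : List ℕ} (hC : C.Pairwise (· ≤ ·)) :
    ∃ D E, C = D ++ E ∧ (∀ x ∈ D, x ≤ m) ∧ ∀ x ∈ E, m < x := by
  induction C with
  | nil => exact ⟨[], [], by simp⟩
  | cons c C ih =>
    rw [List.pairwise_cons] at hC
    obtain ⟨D, E, rfl, hD, hE⟩ := ih hC.2
    by_cases hc : c ≤ m
    · exact ⟨c :: D, E, rfl, by simpa [hc] using hD, hE⟩
    · refine ⟨[], c :: (D ++ E), rfl, by simp, fun x hx => ?_⟩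
      rcases List.mem_cons.1 hx with rfl | hx
      · omega
      · exact lt_of_lt_of_le (not_le.1 hc) (hC.1 x hx)

theorem IsGoodList.eq_swapWord {n : ℕ} {A C : List ℕ}
    (h : IsGoodList n (A ++ 0 :: 0 :: C)) (hA : 0 ∉ A) (hC : 0 ∉ C) :
    ∃ a L, IsSwapParam n a L ∧
      ∀ p < 2 * n, (A ++ 0 :: 0 :: C)[p]? = some (swapWord a L p) := by
  have hCs : C.Pairwise (· ≤ ·) := by
    rw [List.pairwise_iff_forall_sublist]
    intro x y hs
    have hy : 0 < y := Nat.pos_of_ne_zero fun h0 => hC (h0 ▸ hs.subset (by simp))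
    by_contra! hlt
    refine h.not_132 (x := 0) (y := x) (z := y) ?_ ⟨hy, hlt⟩
    refine List.Sublist.trans ?_ (List.sublist_append_right _ _)
    exact List.Sublist.cons_cons _ (hs.trans (by simp))
  have hAs : A.Pairwise (· ≤ ·) := by
    rw [List.pairwise_iff_forall_sublist]
    intro x y hs
    have hy : 0 < y := Nat.pos_of_ne_zero fun h0 => hA (h0 ▸ hs.subset (by simp))
    by_contra! hlt
    refine h.not_321 (x := x) (y := y) (z := 0) ?_ ⟨hy, hlt⟩
    exact hs.append (l₁ := [x, y]) (r₁ := [0]) (by simp)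
  obtain ⟨D, E, rfl, hDAE, hnil, hlt⟩ : ∃ D E, C = D ++ E ∧ (D ++ (A ++ E)).Pairwise (· ≤ ·) ∧
      (A = [] → D = []) ∧ ∀ m A', A = m :: A' → ∀ x ∈ E, m < x := by
    rcases A with _ | ⟨m, A⟩
    · exact ⟨[], C, by simp, by simpa using hCs, by simp⟩
    · obtain ⟨D, E, rfl, hD, hE⟩ := exists_append_of_pairwise_le m hCs
      refine ⟨D, E, rfl, ?_, by simp, by rintro _ _ ⟨⟩; exact hE⟩
      have hm : ∀ a ∈ m :: A, m ≤ a := by simpa using (List.pairwise_cons.1 hAs).1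
      rw [List.pairwise_append] at hCs
      simp only [List.pairwise_append (l₁ := D), List.pairwise_append (l₁ := m :: A)]
      refine ⟨hCs.1, ⟨hAs, hCs.2.1, fun a ha x hx => ?_⟩, fun d hd x hx => ?_⟩
      · by_contra! hxa
        have hmx := hE x hx
        have ha' : a ∈ A := (List.mem_cons.1 ha).resolve_left (by omega)
        refine h.not_132 (x := m) (y := a) (z := x) ?_ ⟨hmx, hxa⟩
        refine List.Sublist.append (l₁ := [m, a]) (List.Sublist.cons_cons _ ?_) ?_ <;>
          simp [ha', hx]
      · rcases List.mem_append.1 hx with hx | hx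
        · exact (hD d hd).trans (hm x hx)
        · exact (hD d hd).trans (hE x hx).le
  have heq : [0, 0] ++ (D ++ (A ++ E)) = doubled n := by
    refine List.Perm.eq_of_pairwise' (r := (· ≤ ·)) ?_ (pairwise_doubled n) ?_
    · simpa using hDAE
    · refine List.Perm.trans ?_ h.perm
      rw [List.perm_iff_count]
      intro v
      simp only [List.count_append, List.count_cons, List.count_nil]
      omega
  have eD {t : ℕ} (ht : t < D.length) : D[t]? = some ((2 + t) / 2) :=
    getElem?_of_doubled_eq heq ht
  have eA {t : ℕ} (ht : t < A.length) : A[t]? = some ((2 + D.length + t) / 2) := by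
    rw [getElem?_of_doubled_eq (X := [0, 0] ++ D) (by simpa using heq) ht, List.length_append]
    rfl
  have eE {t : ℕ} (ht : t < E.length) : E[t]? = some ((2 + D.length + A.length + t) / 2) := by
    rw [getElem?_of_doubled_eq (X := [0, 0] ++ D ++ A) (Z := []) (by simpa using heq) ht,
      List.length_append, List.length_append]
    rfl
  have hlen := congrArg List.length heq
  simp only [List.length_append, length_doubled, List.length_cons, List.length_nil] at hlen
  refine ⟨D.length + 2, A.length, ⟨by omega, by omega, ?_, fun hone => ?_, fun hzero => ?_⟩,
    fun p hp => ?_⟩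
  · by_contra! hpar
    have hpos : A.length ≠ 0 := fun h0 => by
      simp [hnil (List.length_eq_zero_iff.1 h0)] at hpar
    have hmD := List.mem_of_getElem? (eD (t := D.length - 1) (by omega))
    have hME := List.mem_of_getElem? (eE (t := 0) (by omega))
    have hMA := List.mem_of_getElem? (eA (t := A.length - 1) (by omega))
    have hmA := eA (t := 0) (by omega)
    rw [show (2 + (D.length - 1)) / 2 = (2 + D.length + 0) / 2 by omega] at hmD
    rw [show (2 + D.length + A.length + 0) / 2 = (2 + D.length + (A.length - 1)) / 2 by omega]
      at hME
    have hne : (2 + D.length + 0) / 2 ≠ (2 + D.length + (A.length - 1)) / 2 := by omega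
    generalize (2 + D.length + 0) / 2 = m at *
    generalize (2 + D.length + (A.length - 1)) / 2 = M at *
    rcases A with _ | ⟨a, A⟩
    · simp at hmA
    · obtain rfl : a = m := by simpa using hmA
      refine hne (h.not_cross ?_)
      have hMA' : M ∈ A := (List.mem_cons.1 hMA).resolve_left hne.symm
      refine List.Sublist.append (l₁ := [a, M])
        (List.Sublist.cons_cons _ (List.singleton_sublist.2 hMA')) ?_
      exact ((List.singleton_sublist.2 hmD).append (List.singleton_sublist.2 hME)).trans (by simp)
  · by_contra hev
    obtain ⟨m, rfl⟩ := List.length_eq_one_iff.1 hone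
    have hmE := List.mem_of_getElem? (eE (t := 0) (by omega))
    have hm : m = (2 + D.length + 0) / 2 := by simpa using eA (t := 0) (by omega)
    have := hlt m [] rfl _ hmE
    omega
  · simp [hnil (List.length_eq_zero_iff.1 hzero)]
  · unfold swapWord
    rcases lt_or_ge p A.length with h1 | h1
    · rw [List.getElem?_append_left h1, eA h1, Option.some_inj]
      split_ifs <;> omega
    obtain ⟨q, rfl⟩ := Nat.exists_eq_add_of_le h1
    rw [List.getElem?_append_right h1, Nat.add_sub_cancel_left]
    rcases q with _ | _ | q
    · rw [List.getElem?_cons_zero, Option.some_inj]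
      split_ifs <;> omega
    · rw [List.getElem?_cons_succ, List.getElem?_cons_zero, Option.some_inj]
      split_ifs <;> omega
    rw [List.getElem?_cons_succ, List.getElem?_cons_succ]
    rcases lt_or_ge q D.length with h2 | h2
    · rw [List.getElem?_append_left h2, eD h2, Option.some_inj]
      split_ifs <;> omega
    obtain ⟨r, rfl⟩ := Nat.exists_eq_add_of_le h2
    rw [List.getElem?_append_right h2, Nat.add_sub_cancel_left, eE (by omega), Option.some_inj]
    split_ifs <;> omega

theorem codeWord_lt {n : ℕ} (hn : 0 < n) (c : Code n) (p : Fin (2 * n)) : codeWord c p < n := by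
  rcases codeParam_cases hn c with ⟨a, L, h, hc⟩ | ⟨k, l, hkl, hl, hc⟩
  · simp only [codeWord, hc, Sum.elim_inl]
    exact swapWord_lt h.add_le p.2
  · simp only [codeWord, hc, Sum.elim_inr]
    exact zeroWord_lt hkl hl p.2

theorem isGood_codeWord {n : ℕ} (hn : 0 < n) (c : Code n) :
    IsGood n fun p => ⟨codeWord c p, codeWord_lt hn c p⟩ := by
  have hf := codeWord_lt hn c
  rcases codeParam_cases hn c with ⟨a, L, h, hc⟩ | ⟨k, l, hkl, hl, hc⟩
  · simp only [codeWord, hc, Sum.elim_inl] at hf ⊢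
    exact isGood_swapWord h hf
  · simp only [codeWord, hc, Sum.elim_inr] at hf ⊢
    exact isGood_zeroWord hkl hl hf

theorem codeWord_inj {n : ℕ} (hn : 0 < n) {c c' : Code n}
    (heq : ∀ p < 2 * n, codeWord c p = codeWord c' p) : c = c' := by
  apply codeParam_injective
  rcases codeParam_cases hn c with ⟨a, L, h, hc⟩ | ⟨k, l, hkl, hl, hc⟩ <;>
    rcases codeParam_cases hn c' with ⟨a', L', h', hc'⟩ | ⟨k', l', hkl', hl', hc'⟩ <;>
    simp only [codeWord, hc, hc', Sum.elim_inl, Sum.elim_inr] at heq ⊢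
  · obtain ⟨rfl, rfl⟩ := swapWord_inj h h' heq
    rfl
  · exact (swapWord_ne_zeroWord h hkl' heq).elim
  · exact (swapWord_ne_zeroWord h' hkl fun p hp => (heq p hp).symm).elim
  · obtain ⟨rfl, rfl⟩ := zeroWord_inj hkl hl hkl' heq
    rfl

theorem IsGood.exists_codeWord {n : ℕ} (hn : 0 < n) {π : Fin (2 * n) → Fin n} (h : IsGood n π) :
    ∃ c : Code n, ∀ p : Fin (2 * n), codeWord c p = π p := by
  have hw : ∀ p : Fin (2 * n), (letters π)[(p : ℕ)]? = some (π p : ℕ) := fun p => by simp [letters]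
  obtain ⟨A, B, C, hABC, hA, hB, hC⟩ := h.isGoodList.exists_split hn
  have hgood := hABC ▸ h.isGoodList
  rw [hABC] at hw
  rcases eq_or_ne B [] with rfl | hne
  · obtain ⟨a, L, hp, hv⟩ := hgood.eq_swapWord hA hC
    obtain ⟨c, hc⟩ := exists_codeParam_eq_inl hp
    refine ⟨c, fun p => ?_⟩
    rw [← Option.some_inj, ← hw, List.nil_append, hv p p.2, codeWord, hc, Sum.elim_inl]
  · obtain ⟨k, l, hkl, hl, hv⟩ := hgood.eq_zeroWord hA hB hC hne
    obtain ⟨c, hc⟩ := exists_codeParam_eq_inr hkl hl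
    refine ⟨c, fun p => ?_⟩
    rw [← Option.some_inj, ← hw, hv p p.2, codeWord, hc, Sum.elim_inr]

theorem card_code {n : ℕ} (hn : 2 ≤ n) : Nat.card (Code n) = 2 * n ^ 2 - 3 * n + 2 := by
  obtain ⟨m, rfl⟩ := Nat.exists_eq_add_of_le' hn
  have h : 2 * (m + 2) ^ 2 = 3 * (m + 2) + (2 * m ^ 2 + 5 * m + 2) := by ring
  rw [h, Nat.add_sub_cancel_left]
  simp only [Nat.card_eq_fintype_card, Fintype.card_sum, Fintype.card_prod, Fintype.card_fin,
    Fintype.card_unit, show m + 2 - 1 = m + 1 by omega]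
  ring

theorem quasiStirling_avoiding_132_321 (n : ℕ) (hn : 2 ≤ n) :
    Nat.card {π : Fin (2 * n) → Fin n //
      IsQuasiStirling n π ∧ Avoids3 n ![1, 3, 2] π ∧ Avoids3 n ![3, 2, 1] π} =
      2 * n ^ 2 - 3 * n + 2 := by
  have hn' : 0 < n := by omega
  rw [← card_code hn]
  refine (Nat.card_eq_of_bijective
    (fun c : Code n => ⟨fun p => ⟨codeWord c p, codeWord_lt hn' c p⟩, isGood_codeWord hn' c⟩)
    ⟨fun c c' hcc' => ?_, fun ⟨π, hπ⟩ => ?_⟩).symm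
  · refine codeWord_inj hn' fun p hp => ?_
    exact congrArg Fin.val (congrFun (congrArg Subtype.val hcc') ⟨p, hp⟩)
  · obtain ⟨c, hc⟩ := IsGood.exists_codeWord hn' hπ
    exact ⟨c, Subtype.ext (funext fun p => Fin.ext (hc p))⟩
end

section
/- For every n ≥ 2, the number of quasi-Stirling permutations of the multiset [n,n] that avoid all of the patterns 132, 213, and 321 equals 2n. -/
namespace QuasiStirling

/-- The cyclic successor on `Fin N`. -/
def cycSucc {N : ℕ} (i : Fin N) : Fin N :=
  ⟨if i.val + 1 < N then i.val + 1 else 0, by have := i.isLt; split_ifs <;> omega⟩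

/-- The position reached from `i` after `m` steps around the cycle of length `N`. -/
def cycShift {N : ℕ} (i : Fin N) (m : ℕ) (hm : m < N) : Fin N :=
  ⟨if i.val + m < N then i.val + m else i.val + m - N, by
    have := i.isLt; split_ifs <;> omega⟩

/-- The word `1 1 2 2 … n n`, rotated cyclically so that it starts at position `r`. -/
def rotatedWord (n : ℕ) (r i : Fin (2 * n)) : Fin n :=
  ⟨(if r.val ≤ i.val then i.val - r.val else i.val + 2 * n - r.val) / 2, by
    have := i.isLt; have := r.isLt; split_ifs <;> omega⟩

/-- `i`, `j`, `k` occur in this cyclic order. -/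
def Cyc {N : ℕ} (i j k : Fin N) : Prop :=
  (i < j ∧ j < k) ∨ (j < k ∧ k < i) ∨ (k < i ∧ i < j)

lemma contains3_of_lt {n : ℕ} {σ : Fin 3 → ℕ} {π : Fin (2 * n) → Fin n} {i j k : Fin (2 * n)}
    (hij : i < j) (hjk : j < k)
    (h : ∀ a b : Fin 3, π (![i, j, k] a) < π (![i, j, k] b) ↔ σ a < σ b) :
    Contains3 n σ π := by
  refine ⟨![i, j, k], ?_, h⟩
  rw [Fin.strictMono_iff_lt_succ]
  intro a
  fin_cases a
  · exact hij
  · exact hjk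

lemma cyc_of_lt {n : ℕ} {π : Fin (2 * n) → Fin n}
    (h132 : Avoids3 n ![1, 3, 2] π) (h213 : Avoids3 n ![2, 1, 3] π)
    (h321 : Avoids3 n ![3, 2, 1] π) {i j k : Fin (2 * n)} (hij : i < j) (hjk : j < k)
    (h₁ : π i ≠ π j) (h₂ : π j ≠ π k) (h₃ : π i ≠ π k) : Cyc (π i) (π j) (π k) := by
  by_contra hc
  simp only [Cyc, Fin.lt_def] at hc
  rw [Ne, Fin.ext_iff] at h₁ h₂ h₃
  rcases lt_or_ge (π i).val (π j).val with h | h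
  · refine h132 (contains3_of_lt hij hjk fun a b => ?_)
    fin_cases a <;> fin_cases b <;> simp <;> omega
  · rcases lt_or_ge (π j).val (π k).val with h' | h'
    · refine h213 (contains3_of_lt hij hjk fun a b => ?_)
      fin_cases a <;> fin_cases b <;> simp <;> omega
    · refine h321 (contains3_of_lt hij hjk fun a b => ?_)
      fin_cases a <;> fin_cases b <;> simp <;> omega

lemma cyc_map {n : ℕ} {π : Fin (2 * n) → Fin n}
    (h132 : Avoids3 n ![1, 3, 2] π) (h213 : Avoids3 n ![2, 1, 3] π)
    (h321 : Avoids3 n ![3, 2, 1] π) {i j k : Fin (2 * n)} (h : Cyc i j k)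
    (h₁ : π i ≠ π j) (h₂ : π j ≠ π k) (h₃ : π i ≠ π k) : Cyc (π i) (π j) (π k) := by
  rcases h with ⟨a, b⟩ | ⟨a, b⟩ | ⟨a, b⟩
  · exact cyc_of_lt h132 h213 h321 a b h₁ h₂ h₃
  · have := cyc_of_lt h132 h213 h321 a b h₂ h₃.symm h₁.symm
    unfold Cyc at *; tauto
  · have := cyc_of_lt h132 h213 h321 a b h₃.symm h₁ h₂.symm
    unfold Cyc at *; tauto

lemma exists_two_occurrences {n : ℕ} {π : Fin (2 * n) → Fin n} (h : IsMultisetPerm n π)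
    (v : Fin n) : ∃ a b, a < b ∧ π a = v ∧ π b = v ∧ ∀ c, π c = v → c = a ∨ c = b := by
  obtain ⟨⟨a, ha⟩, ⟨b, hb⟩, hab, hU⟩ := Nat.card_eq_two_iff.1 (h v)
  have key : ∀ c, π c = v → c = a ∨ c = b := fun c hc => by
    have : (⟨c, hc⟩ : {i // π i = v}) ∈ ({⟨a, ha⟩, ⟨b, hb⟩} : Set _) := hU ▸ Set.mem_univ _
    simpa using this
  rcases lt_or_gt_of_ne (fun e => hab (Subtype.ext e) : a ≠ b) with hlt | hlt
  · exact ⟨a, b, hlt, ha, hb, key⟩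
  · exact ⟨b, a, hlt, hb, ha, fun c hc => (key c hc).symm⟩

lemma map_cycSucc {n : ℕ} (hn : 2 ≤ n) {π : Fin (2 * n) → Fin n} (h : IsMultisetPerm n π)
    (h132 : Avoids3 n ![1, 3, 2] π) (h213 : Avoids3 n ![2, 1, 3] π)
    (h321 : Avoids3 n ![3, 2, 1] π) (i : Fin (2 * n)) :
    π (cycSucc i) = π i ∨ π (cycSucc i) = cycSucc (π i) := by
  by_contra! hc
  obtain ⟨hc₁, hc₂⟩ := hc
  obtain ⟨k, -, -, hk, -⟩ := exists_two_occurrences h (cycSucc (π i))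
  have hne : π i ≠ π k := by
    rw [hk, Ne, Fin.ext_iff]
    simp only [cycSucc]
    split_ifs <;> omega
  have hik : i ≠ k := fun e => hne (e ▸ rfl)
  have hsk : cycSucc i ≠ k := fun e => hc₂ (e ▸ hk)
  have hcyc : Cyc i (cycSucc i) k := by
    simp only [Cyc, cycSucc, Ne, Fin.lt_def, Fin.ext_iff] at hik hsk ⊢
    split_ifs at hsk ⊢ <;> omega
  have := cyc_map h132 h213 h321 hcyc hc₁.symm (hk ▸ hc₂) hne
  rw [hk] at this
  rw [Ne, Fin.ext_iff] at hc₁ hc₂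
  simp only [Cyc, Fin.lt_def] at this
  generalize π (cycSucc i) = b at *
  simp only [cycSucc] at this hc₂
  split_ifs at this hc₂ <;> omega

lemma exists_adjacent_occurrences {n : ℕ} (hn : 2 ≤ n) {π : Fin (2 * n) → Fin n}
    (h : IsQuasiStirling n π)
    (h132 : Avoids3 n ![1, 3, 2] π) (h213 : Avoids3 n ![2, 1, 3] π)
    (h321 : Avoids3 n ![3, 2, 1] π) (v : Fin n) :
    ∃ a, π a = v ∧ π (cycSucc a) = v ∧ ∀ c, π c = v → c = a ∨ c = cycSucc a := by
  obtain ⟨hm, h1, h2⟩ := h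
  have cross : ∀ i j k l, i < j → j < k → k < l → π i = π k → π j = π l → π i = π j := by
    intro i j k l hij hjk hkl e₁ e₂
    by_contra hne
    rcases lt_or_gt_of_ne hne with hlt | hlt
    · exact h1 ⟨i, j, k, l, hij, hjk, hkl, e₁, e₂, hlt⟩
    · exact h2 ⟨i, j, k, l, hij, hjk, hkl, e₁, e₂, hlt⟩
  have hs : ∀ i : Fin (2 * n), cycSucc i ≠ i := fun i e => by
    rw [Fin.ext_iff] at e
    simp only [cycSucc] at e
    split_ifs at e <;> omega
  obtain ⟨a, b, hab, ha, hb, key⟩ := exists_two_occurrences hm v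
  by_cases hsa : π (cycSucc a) = v
  · have hsab := (key _ hsa).resolve_left (hs a)
    exact ⟨a, ha, hsa, fun c hc => hsab ▸ key c hc⟩
  by_cases hsb : π (cycSucc b) = v
  · have hsba := (key _ hsb).resolve_right (hs b)
    exact ⟨b, hb, hsb, fun c hc => hsba ▸ (key c hc).symm⟩
  exfalso
  have ea := (map_cycSucc hn hm h132 h213 h321 a).resolve_left (by rwa [ha])
  have eb := (map_cycSucc hn hm h132 h213 h321 b).resolve_left (by rwa [hb])
  rw [ha] at ea
  rw [hb] at eb
  have hsab : cycSucc a ≠ b := fun e => hsa (e ▸ hb)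
  have hsba : cycSucc b ≠ a := fun e => hsb (e ▸ ha)
  have lt₁ : a < cycSucc a ∧ cycSucc a < b := by
    simp only [cycSucc, Ne, Fin.lt_def, Fin.ext_iff] at hab hsab ⊢
    split_ifs at hsab ⊢ <;> omega
  have lt₂ : b < cycSucc b ∨ cycSucc b < a := by
    simp only [cycSucc, Ne, Fin.lt_def, Fin.ext_iff] at hsba ⊢
    split_ifs at hsba ⊢ <;> omega
  rcases lt₂ with lt₂ | lt₂
  · exact hsa ((cross _ _ _ _ lt₁.1 lt₁.2 lt₂ (ha.trans hb.symm) (ea.trans eb.symm)).symm.trans ha)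
  · exact hsb ((cross _ _ _ _ lt₂ lt₁.1 lt₁.2 (eb.trans ea.symm) (ha.trans hb.symm)).trans ha)

lemma exists_eq_rotatedWord {n : ℕ} (hn : 2 ≤ n) {π : Fin (2 * n) → Fin n}
    (h : IsQuasiStirling n π)
    (h132 : Avoids3 n ![1, 3, 2] π) (h213 : Avoids3 n ![2, 1, 3] π)
    (h321 : Avoids3 n ![3, 2, 1] π) : ∃ r, rotatedWord n r = π := by
  have adj := exists_adjacent_occurrences hn h h132 h213 h321
  have shift_succ : ∀ (r : Fin (2 * n)) (m : ℕ) (hm : m + 1 < 2 * n),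
      cycSucc (cycShift r m (by omega)) = cycShift r (m + 1) hm := fun r m hm => by
    have := r.isLt
    rw [Fin.ext_iff]
    simp only [cycSucc, cycShift]
    split_ifs <;> omega
  obtain ⟨r, hr₀, hr₁, -⟩ := adj ⟨0, by omega⟩
  have walk : ∀ (k : ℕ) (hk : k < n), π (cycShift r (2 * k) (by omega)) = ⟨k, hk⟩ ∧
      π (cycShift r (2 * k + 1) (by omega)) = ⟨k, hk⟩ := by
    intro k
    induction k with
    | zero =>
      intro hk
      have e : cycShift r (2 * 0) (by omega) = r := by
        simp [cycShift]
      refine ⟨by rw [e, hr₀], ?_⟩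
      rw [← shift_succ, e, hr₁]
    | succ k ih =>
      intro hk
      obtain ⟨e₀, e₁⟩ := ih (by omega)
      have e₂ : π (cycShift r (2 * k + 2) (by omega)) = ⟨k + 1, hk⟩ := by
        have hstep := map_cycSucc hn h.1 h132 h213 h321 (cycShift r (2 * k + 1) (by omega))
        rw [shift_succ r (2 * k + 1) (by omega), e₁] at hstep
        rcases hstep with e | e
        · obtain ⟨a, b, -, -, -, key⟩ := exists_two_occurrences h.1 (⟨k, by omega⟩ : Fin n)
          have c₀ := key _ e₀
          have c₁ := key _ e₁
          have c₂ := key _ e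
          have := r.isLt
          simp only [cycShift, Fin.ext_iff] at c₀ c₁ c₂
          split_ifs at c₀ c₁ c₂ <;> omega
        · rw [e]
          simp [cycSucc, hk]
      refine ⟨e₂, ?_⟩
      obtain ⟨a, ha₀, ha, key⟩ := adj ⟨k + 1, hk⟩
      have hsucc := shift_succ r (2 * k + 2) (by omega)
      rcases key _ e₂ with e | e
      · rw [e] at hsucc
        exact hsucc ▸ ha
      · exfalso
        have hinj : cycShift r (2 * k + 1) (by omega) = a := by
          rw [← shift_succ r (2 * k + 1) (by omega)] at e
          generalize cycShift r (2 * k + 1) (by omega) = q at e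
          simp only [cycSucc, Fin.ext_iff] at e ⊢
          split_ifs at e <;> omega
        rw [hinj, ha₀, Fin.ext_iff] at e₁
        simp at e₁
  refine ⟨r, funext fun i => ?_⟩
  have hi := (rotatedWord n r i).isLt
  obtain ⟨e₀, e₁⟩ := walk _ hi
  have : i = cycShift r (2 * (rotatedWord n r i).val) (by omega) ∨
      i = cycShift r (2 * (rotatedWord n r i).val + 1) (by omega) := by
    have := i.isLt
    have := r.isLt
    simp only [cycShift, rotatedWord, Fin.ext_iff]
    split_ifs <;> omega
  rcases this with e | e
  · rw [← e] at e₀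
    exact e₀.symm
  · rw [← e] at e₁
    exact e₁.symm

lemma rotatedWord_isMultisetPerm (n : ℕ) (r : Fin (2 * n)) :
    IsMultisetPerm n (rotatedWord n r) := by
  intro v
  have := r.isLt
  have := v.isLt
  refine Nat.card_eq_two_iff.2 ⟨⟨cycShift r (2 * v) (by omega), ?_⟩,
    ⟨cycShift r (2 * v + 1) (by omega), ?_⟩, ?_, ?_⟩
  · simp only [rotatedWord, cycShift, Fin.ext_iff]
    split_ifs <;> omega
  · simp only [rotatedWord, cycShift, Fin.ext_iff]
    split_ifs <;> omega
  · simp only [cycShift, Ne, Subtype.mk.injEq, Fin.ext_iff]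
    split_ifs <;> omega
  · refine Set.eq_univ_of_forall fun ⟨i, hi⟩ => ?_
    have := i.isLt
    simp only [Set.mem_insert_iff, Set.mem_singleton_iff, Subtype.mk.injEq]
    simp only [rotatedWord, cycShift, Fin.ext_iff] at hi ⊢
    split_ifs at hi ⊢ <;> omega

lemma rotatedWord_isQuasiStirling (n : ℕ) (r : Fin (2 * n)) :
    IsQuasiStirling n (rotatedWord n r) := by
  refine ⟨rotatedWord_isMultisetPerm n r, ?_, ?_⟩ <;>
  · rintro ⟨i, j, k, l, hij, hjk, hkl, e₁, e₂, hlt⟩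
    have := l.isLt
    have := r.isLt
    simp only [rotatedWord, Fin.ext_iff, Fin.lt_def] at hij hjk hkl e₁ e₂ hlt
    split_ifs at e₁ e₂ hlt <;> omega

lemma rotatedWord_avoids3 (n : ℕ) (r : Fin (2 * n)) {σ : Fin 3 → ℕ}
    (hσ : (σ 0 < σ 2 ∧ σ 2 < σ 1) ∨ (σ 1 < σ 0 ∧ σ 0 < σ 2) ∨ (σ 2 < σ 1 ∧ σ 1 < σ 0)) :
    Avoids3 n σ (rotatedWord n r) := by
  rintro ⟨f, hf, h⟩
  have h01 : f 0 < f 1 := hf (by decide)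
  have h12 : f 1 < f 2 := hf (by decide)
  simp only [← h] at hσ
  have := (f 2).isLt
  have := r.isLt
  simp only [rotatedWord, Fin.lt_def] at h01 h12 hσ
  split_ifs at hσ <;> omega

lemma rotatedWord_injective {n : ℕ} (hn : 2 ≤ n) : Function.Injective (rotatedWord n) := by
  intro r s hrs
  have h₁ := congrFun hrs r
  have h₂ := congrFun hrs (cycSucc r)
  have := r.isLt
  have := s.isLt
  simp only [rotatedWord, cycSucc, Fin.ext_iff] at h₁ h₂ ⊢
  split_ifs at h₁ h₂ <;> omega

end QuasiStirling

open QuasiStirling in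
theorem quasiStirling_avoiding_132_213_321 (n : ℕ) (hn : 2 ≤ n) :
    Nat.card {π : Fin (2 * n) → Fin n //
      IsQuasiStirling n π ∧ Avoids3 n ![1, 3, 2] π ∧ Avoids3 n ![2, 1, 3] π ∧
        Avoids3 n ![3, 2, 1] π} = 2 * n := by
  refine .trans (Nat.card_eq_of_bijective (fun r => ⟨rotatedWord n r, rotatedWord_isQuasiStirling n r,
    rotatedWord_avoids3 n r (by simp), rotatedWord_avoids3 n r (by simp),
    rotatedWord_avoids3 n r (by simp)⟩) ⟨fun r s hrs => ?_, ?_⟩).symm (Nat.card_fin (2 * n))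
  · exact rotatedWord_injective hn (congrArg Subtype.val hrs)
  · rintro ⟨π, h, h132, h213, h321⟩
    obtain ⟨r, hr⟩ := exists_eq_rotatedWord hn h h132 h213 h321
    exact ⟨r, Subtype.ext hr⟩
end
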